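/- arXiv:1708.08538 — 3 statements merged into one kernel-verified Lean document; each statement's English description precedes it below -/
import Mathlib

section
/- Let X be a complex Banach space and Δ : S(c₀(Γ)) → S(X) a surjective isometry. For each n ∈ Γ let σ_n : ℂ → ℂ be the identity or complex conjugation so that Δ(λe_n) = σ_n(λ)Δ(e_n) for all λ ∈ 𝕋. Then for all distinct n₁,…,n_k ∈ Γ and all λ₁,…,λ_k ∈ ℂ \ {0} with max_j |λ_j| = 1, Δ(∑_{j=1}^k λ_j e_{n_j}) = ∑_{j=1}^k σ_{n_j}(λ_j) Δ(e_{n_j}). -/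
open ZeroAtInfty Metric

/-- The canonical basis vector `e n` of `c₀(Γ)`. -/
noncomputable def stdBasis {Γ : Type*} [TopologicalSpace Γ] [DiscreteTopology Γ] [DecidableEq Γ]
    (n : Γ) : C₀(Γ, ℂ) where
  toFun := fun k => if k = n then 1 else 0
  continuous_toFun := continuous_of_discreteTopology
  zero_at_infty' := by
    have h : (fun k => if k = n then (1 : ℂ) else 0) =ᶠ[Filter.cocompact Γ] 0 := by
      refine Filter.mem_cocompact.2 ⟨{n}, isCompact_singleton, ?_⟩
      intro k hk
      simp only [Set.mem_compl_iff, Set.mem_singleton_iff] at hk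
      simp [hk]
    exact Filter.Tendsto.congr' h.symm tendsto_const_nhds

namespace ZeroAtInftyContinuousMap

theorem norm_le_iff {Γ : Type*} [TopologicalSpace Γ] (f : C₀(Γ, ℂ)) {C : ℝ} (hC : 0 ≤ C) :
    ‖f‖ ≤ C ↔ ∀ m, ‖f m‖ ≤ C := by
  rw [← norm_toBCF_eq_norm, BoundedContinuousFunction.norm_le hC]
  rfl

theorem norm_apply_le {Γ : Type*} [TopologicalSpace Γ] (f : C₀(Γ, ℂ)) (m : Γ) : ‖f m‖ ≤ ‖f‖ :=
  (norm_le_iff f (norm_nonneg f)).1 le_rfl m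

end ZeroAtInftyContinuousMap

open ZeroAtInftyContinuousMap

/-- A point of the disc is determined by its distances, truncated below at `1`, to the points of
the unit circle. -/
theorem Complex.eq_of_forall_max_norm_sub_le {z t : ℂ} (htz : ‖t‖ ≤ ‖z‖)
    (h : ∀ c : ℂ, ‖c‖ = 1 → max ‖z - c‖ 1 ≤ max ‖t - c‖ 1) : z = t := by
  rcases eq_or_ne z 0 with rfl | hz
  · simpa [eq_comm] using htz
  have hz' : 0 < ‖z‖ := norm_pos_iff.2 hz
  have hr : ((‖z‖ : ℝ) : ℂ) ≠ 0 := by exact_mod_cast hz'.ne'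
  have key := h (-(z / ‖z‖)) (by simp [hz])
  have h1 : ‖z - -(z / ‖z‖)‖ = ‖z‖ + 1 := by
    have : z - -(z / ‖z‖) = ((‖z‖ + 1 : ℝ) : ℂ) * (z / ‖z‖) := by
      push_cast
      field_simp
      ring
    rw [this, norm_mul, Complex.norm_real, Real.norm_of_nonneg (by positivity)]
    simp [hz]
  rw [h1] at key
  have h2 : ‖z‖ + 1 ≤ ‖t + z / ‖z‖‖ := by
    rw [sub_neg_eq_add] at key
    rcases le_max_iff.1 ((le_max_left _ _).trans key) with h | h
    · exact h
    · linarith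
  have h4 : ‖z / (‖z‖ : ℂ)‖ = 1 := by simp [hz]
  have h3 : ‖t‖ = ‖z‖ := le_antisymm htz <| by
    linarith [norm_add_le t (z / ‖z‖)]
  have h5 : ‖t + z / ‖z‖‖ = ‖t‖ + ‖z / (‖z‖ : ℂ)‖ :=
    le_antisymm (norm_add_le _ _) (by linarith)
  have h6 := (sameRay_iff_norm_smul_eq.1 (sameRay_iff_norm_add.2 h5))
  rw [h4, h3, one_smul, Complex.real_smul] at h6
  rw [← h6]
  field_simp

theorem Complex.eq_zero_of_norm_sub_le_of_norm_add_le {z a : ℂ} (ha : ‖a‖ = 1)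
    (h1 : ‖z - a‖ ≤ 1) (h2 : ‖z + a‖ ≤ 1) : z = 0 := by
  have h := parallelogram_law_with_norm ℝ z a
  have : ‖z‖ * ‖z‖ ≤ 0 := by
    nlinarith [norm_nonneg (z - a), norm_nonneg (z + a), norm_nonneg z]
  exact norm_eq_zero.1 (by nlinarith [norm_nonneg z])

theorem Complex.exists_norm_eq_one_add_eq_two_mul {z : ℂ} (hz : ‖z‖ ≤ 1) :
    ∃ b c : ℂ, ‖b‖ = 1 ∧ ‖c‖ = 1 ∧ b + c = 2 * z := by
  set θ := Real.arccos ‖z‖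
  have hθ : Real.cos θ = ‖z‖ := Real.cos_arccos (by linarith [norm_nonneg z]) hz
  refine ⟨Complex.exp ((z.arg + θ : ℝ) * Complex.I), Complex.exp ((z.arg - θ : ℝ) * Complex.I),
    Complex.norm_exp_ofReal_mul_I _, Complex.norm_exp_ofReal_mul_I _, ?_⟩
  have h2 : Complex.exp (θ * Complex.I) + Complex.exp (-θ * Complex.I) = 2 * ‖z‖ := by
    rw [← hθ, Complex.ofReal_cos, Complex.two_cos]
  have h3 : Complex.exp ((z.arg + θ : ℝ) * Complex.I)
      = Complex.exp (z.arg * Complex.I) * Complex.exp (θ * Complex.I) := by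
    rw [← Complex.exp_add]; push_cast; ring_nf
  have h4 : Complex.exp ((z.arg - θ : ℝ) * Complex.I)
      = Complex.exp (z.arg * Complex.I) * Complex.exp (-θ * Complex.I) := by
    rw [← Complex.exp_add]; push_cast; ring_nf
  rw [h3, h4, ← mul_add, h2]
  conv_rhs => rw [← Complex.norm_mul_exp_arg_mul_I z]
  ring

section StdBasis

variable {Γ : Type*} [TopologicalSpace Γ] [DiscreteTopology Γ] [DecidableEq Γ]

theorem stdBasis_apply (n m : Γ) : (stdBasis n : C₀(Γ, ℂ)) m = if m = n then 1 else 0 := rfl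

theorem sum_smul_stdBasis_apply (F : Finset Γ) (a : Γ → ℂ) (m : Γ) :
    (∑ n ∈ F, a n • (stdBasis n : C₀(Γ, ℂ))) m = if m ∈ F then a m else 0 := by
  have h : (∑ n ∈ F, a n • (stdBasis n : C₀(Γ, ℂ))) m
      = ∑ n ∈ F, (a n • (stdBasis n : C₀(Γ, ℂ))) m := by
    induction F using Finset.induction_on with
    | empty => simp
    | insert i F hi ih => simp only [Finset.sum_insert hi, ZeroAtInftyContinuousMap.add_apply, ih]
  simp [h, stdBasis_apply]

theorem neg_smul_stdBasis (n : Γ) (c : ℂ) :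
    (-c) • (stdBasis n : C₀(Γ, ℂ)) = -(c • stdBasis n) := by
  ext m
  simp

theorem norm_smul_stdBasis (n : Γ) (c : ℂ) : ‖c • (stdBasis n : C₀(Γ, ℂ))‖ = ‖c‖ := by
  refine le_antisymm ((norm_le_iff _ (norm_nonneg c)).2 fun m => ?_) ?_
  · by_cases h : m = n <;> simp [stdBasis_apply, h]
  · simpa [stdBasis_apply] using norm_apply_le (c • (stdBasis n : C₀(Γ, ℂ))) n

theorem norm_sum_smul_stdBasis {F : Finset Γ} {a : Γ → ℂ} (hF : F.Nonempty)
    (ha : ∀ n ∈ F, ‖a n‖ = 1) : ‖∑ n ∈ F, a n • (stdBasis n : C₀(Γ, ℂ))‖ = 1 := by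
  refine le_antisymm ((norm_le_iff _ zero_le_one).2 fun m => ?_) ?_
  · rw [sum_smul_stdBasis_apply]
    split_ifs with h
    · exact (ha m h).le
    · simp
  · obtain ⟨m, hm⟩ := hF
    simpa [sum_smul_stdBasis_apply, hm, ha m hm] using
      norm_apply_le (∑ n ∈ F, a n • (stdBasis n : C₀(Γ, ℂ))) m

theorem max_norm_sub_smul_stdBasis {x : C₀(Γ, ℂ)} (hx : ‖x‖ ≤ 1) (n : Γ) (c : ℂ) :
    max ‖x - c • stdBasis n‖ 1 = max ‖x n - c‖ 1 := by
  refine le_antisymm (max_le ((norm_le_iff _ (by positivity)).2 fun m => ?_) (le_max_right _ _))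
    (max_le_max_right _ ?_)
  · by_cases h : m = n
    · simp [stdBasis_apply, h]
    · simpa [stdBasis_apply, h] using Or.inr ((norm_apply_le x m).trans hx)
  · simpa [stdBasis_apply] using norm_apply_le (x - c • stdBasis n) n

/-- A point of the unit ball of `c₀(Γ)` is determined by its distances, truncated below at `1`, to
the unimodular multiples of the basis vectors. -/
theorem eq_of_forall_max_norm_sub_smul_stdBasis_eq {x y : C₀(Γ, ℂ)} (hx : ‖x‖ ≤ 1) (hy : ‖y‖ ≤ 1)
    (h : ∀ (n : Γ) (c : ℂ), ‖c‖ = 1 →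
      max ‖x - c • stdBasis n‖ 1 = max ‖y - c • stdBasis n‖ 1) : x = y := by
  ext n
  have h' : ∀ c : ℂ, ‖c‖ = 1 → max ‖x n - c‖ 1 = max ‖y n - c‖ 1 := fun c hc => by
    rw [← max_norm_sub_smul_stdBasis hx, ← max_norm_sub_smul_stdBasis hy, h n c hc]
  rcases le_total ‖y n‖ ‖x n‖ with hle | hle
  · exact Complex.eq_of_forall_max_norm_sub_le hle fun c hc => (h' c hc).le
  · exact (Complex.eq_of_forall_max_norm_sub_le hle fun c hc => (h' c hc).ge).symm

end StdBasis

/-- `f` restricts to a surjective isometry from the unit sphere of `c₀(Γ)` onto that of `X` which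
sends `c • e n` to `σ n c • f (e n)` for unimodular `c`. -/
structure IsSphereIsometry {Γ : Type*} [TopologicalSpace Γ] [DiscreteTopology Γ] [DecidableEq Γ]
    {X : Type*} [NormedAddCommGroup X] [NormedSpace ℂ X]
    (f : C₀(Γ, ℂ) → X) (σ : Γ → ℂ ≃ₗᵢ[ℝ] ℂ) : Prop where
  norm_map : ∀ x, ‖x‖ = 1 → ‖f x‖ = 1
  norm_map_sub : ∀ x y, ‖x‖ = 1 → ‖y‖ = 1 → ‖f x - f y‖ = ‖x - y‖
  exists_eq : ∀ w : X, ‖w‖ = 1 → ∃ x, ‖x‖ = 1 ∧ f x = w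
  map_smul : ∀ (n : Γ) (c : ℂ), ‖c‖ = 1 → f (c • stdBasis n) = σ n c • f (stdBasis n)

namespace IsSphereIsometry

variable {Γ : Type*} [TopologicalSpace Γ] [DiscreteTopology Γ] [DecidableEq Γ]
  {X : Type*} [NormedAddCommGroup X] [NormedSpace ℂ X]
  {f : C₀(Γ, ℂ) → X} {σ : Γ → ℂ ≃ₗᵢ[ℝ] ℂ}

theorem norm_stdBasis (n : Γ) : ‖(stdBasis n : C₀(Γ, ℂ))‖ = 1 := by
  simpa using norm_smul_stdBasis n (1 : ℂ)

theorem norm_sub_smul (hf : IsSphereIsometry f σ) {x : C₀(Γ, ℂ)} (hx : ‖x‖ = 1) (n : Γ) {c : ℂ}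
    (hc : ‖c‖ = 1) : ‖f x - σ n c • f (stdBasis n)‖ = ‖x - c • stdBasis n‖ := by
  rw [← hf.map_smul n c hc, hf.norm_map_sub x _ hx (by rw [norm_smul_stdBasis, hc])]

theorem map_neg (hf : IsSphereIsometry f σ) {x : C₀(Γ, ℂ)} (hx : ‖x‖ = 1) : f (-x) = -f x := by
  obtain ⟨y, hy, hyx⟩ := hf.exists_eq (-f x) (by rw [norm_neg, hf.norm_map x hx])
  rw [← hyx]
  congr 1
  refine eq_of_forall_max_norm_sub_smul_stdBasis_eq (by simp [hx]) hy.le fun n c hc => ?_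
  have h1 : ‖-x - c • stdBasis n‖ = ‖x - (-c) • stdBasis n‖ := by
    rw [← norm_neg, neg_sub, sub_neg_eq_add, neg_smul_stdBasis, sub_neg_eq_add, add_comm]
  rw [h1, ← hf.norm_sub_smul hx n (by rwa [norm_neg]), ← hf.norm_sub_smul hy n hc, hyx,
    _root_.map_neg, neg_smul, sub_neg_eq_add, ← neg_add', norm_neg]

/-- Changing the sign of a single coordinate of a unimodular combination. -/
theorem map_sum_sub_map_sum_update (hf : IsSphereIsometry f σ) {F : Finset Γ} {a b : Γ → ℂ}
    (ha : ∀ m ∈ F, ‖a m‖ = 1) {n : Γ} (hn : n ∈ F) (hbn : b n = -a n)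
    (hb : ∀ m ∈ F, m ≠ n → b m = a m) :
    f (∑ m ∈ F, a m • stdBasis m) - f (∑ m ∈ F, b m • stdBasis m)
      = (2 : ℂ) • (σ n (a n) • f (stdBasis n)) := by
  have hb1 : ∀ m ∈ F, ‖b m‖ = 1 := fun m hm => by
    by_cases h : m = n
    · rw [h, hbn, norm_neg, ha n hn]
    · rw [hb m hm h, ha m hm]
  have hF : F.Nonempty := ⟨n, hn⟩
  set p : C₀(Γ, ℂ) := ∑ m ∈ F, a m • stdBasis m with hp
  set q : C₀(Γ, ℂ) := -∑ m ∈ F, b m • stdBasis m with hq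
  have hp1 : ‖p‖ = 1 := norm_sum_smul_stdBasis hF ha
  have hq0 : ‖∑ m ∈ F, b m • (stdBasis m : C₀(Γ, ℂ))‖ = 1 := norm_sum_smul_stdBasis hF hb1
  have hq1 : ‖q‖ = 1 := by rw [hq, norm_neg, hq0]
  have hpa : ∀ m, p m = if m ∈ F then a m else 0 := sum_smul_stdBasis_apply F a
  have hqa : ∀ m, q m = if m = n then a n else if m ∈ F then -a m else 0 := fun m => by
    rw [hq, ZeroAtInftyContinuousMap.neg_apply, sum_smul_stdBasis_apply]
    by_cases h : m = n
    · simp [h, hn, hbn]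
    · by_cases hm : m ∈ F
      · simp [h, hm, hb m hm h]
      · simp [h, hm]
  have hfq : f (∑ m ∈ F, b m • stdBasis m) = -f q := by
    rw [hq, hf.map_neg hq0, neg_neg]
  have hpq : p - -q = ((2 : ℂ) * a n) • stdBasis n := by
    rw [sub_neg_eq_add]
    ext m
    rw [ZeroAtInftyContinuousMap.add_apply, hpa, hqa, ZeroAtInftyContinuousMap.smul_apply,
      stdBasis_apply]
    by_cases h : m = n
    · simp [h, hn, two_mul]
    · by_cases hm : m ∈ F <;> simp [h, hm]
  have hsum : ‖f p + f q‖ = 2 := by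
    rw [← neg_neg (f q), ← hf.map_neg hq1, ← sub_eq_add_neg,
      hf.norm_map_sub p _ hp1 (by rwa [norm_neg]), hpq, norm_smul_stdBasis, norm_mul, ha n hn]
    simp
  obtain ⟨x, hx1, hx⟩ := hf.exists_eq ((1 / 2 : ℂ) • (f p + f q))
    (by rw [norm_smul, hsum]; norm_num)
  have hbound : ∀ v : X, ‖f x - v‖ ≤ (‖f p - v‖ + ‖f q - v‖) / 2 := fun v => by
    have : f x - v = (1 / 2 : ℂ) • ((f p - v) + (f q - v)) := by
      rw [hx]; module
    rw [this, norm_smul]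
    have := norm_add_le (f p - v) (f q - v)
    norm_num
    linarith
  have hdist : ∀ z : C₀(Γ, ℂ), ‖z‖ = 1 → ‖x - z‖ ≤ (‖p - z‖ + ‖q - z‖) / 2 := fun z hz => by
    simpa only [hf.norm_map_sub _ _ hx1 hz, hf.norm_map_sub _ _ hp1 hz,
      hf.norm_map_sub _ _ hq1 hz] using hbound (f z)
  have hpq2 : ‖p - q‖ ≤ 2 := (norm_sub_le _ _).trans (by linarith)
  have hxp : ‖x - p‖ ≤ 1 := (hdist p hp1).trans (by
    rw [sub_self, norm_zero, norm_sub_rev]; linarith)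
  have hxq : ‖x - q‖ ≤ 1 := (hdist q hq1).trans (by
    rw [sub_self, norm_zero]; linarith)
  have hcoord : ∀ (m : Γ) (c : ℂ), ‖c‖ = 1 →
      max ‖x m - c‖ 1 ≤ (max ‖p m - c‖ 1 + max ‖q m - c‖ 1) / 2 := fun m c hc => by
    have := hdist (c • stdBasis m) (by rw [norm_smul_stdBasis, hc])
    rw [← max_norm_sub_smul_stdBasis hx1.le, ← max_norm_sub_smul_stdBasis hp1.le,
      ← max_norm_sub_smul_stdBasis hq1.le]
    refine max_le (this.trans ?_) ?_
    · gcongr <;> exact le_max_left _ _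
    · linarith [le_max_right ‖p - c • stdBasis m‖ 1, le_max_right ‖q - c • stdBasis m‖ 1]
  have hx0 : ∀ m, m ≠ n → x m = 0 := fun m hm => by
    by_cases hmF : m ∈ F
    · refine Complex.eq_zero_of_norm_sub_le_of_norm_add_le (ha m hmF) ?_ ?_
      · simpa [hpa, hmF] using (norm_apply_le (x - p) m).trans hxp
      · simpa [hqa, hmF, hm] using (norm_apply_le (x - q) m).trans hxq
    · have hc : ∀ c : ℂ, ‖c‖ = 1 → ‖x m - c‖ ≤ 1 := fun c hc => by
        have := (le_max_left _ _).trans (hcoord m c hc)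
        simpa [hpa, hqa, hm, hmF, hc] using this
      exact Complex.eq_zero_of_norm_sub_le_of_norm_add_le norm_one (hc 1 norm_one)
        (by simpa using hc (-1) (by simp))
  have hxe : x = x n • stdBasis n := by
    ext m
    by_cases h : m = n
    · simp [stdBasis_apply, h]
    · simp [stdBasis_apply, h, hx0 m h]
  have hxn1 : ‖x n‖ = 1 := by rw [← norm_smul_stdBasis n (x n), ← hxe, hx1]
  have hxn : x n = a n := by
    refine Complex.eq_of_forall_max_norm_sub_le (by rw [ha n hn, hxn1]) fun c hc => ?_
    simpa [hpa, hqa, hn] using hcoord n c hc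
  rw [hxe, hxn, hf.map_smul n _ (ha n hn)] at hx
  rw [hfq, hx]
  module

/-- `f` is additive on unimodular combinations of basis vectors. -/
theorem map_sum_of_norm_eq_one (hf : IsSphereIsometry f σ) {F : Finset Γ} (hF : F.Nonempty)
    {a : Γ → ℂ} (ha : ∀ m ∈ F, ‖a m‖ = 1) :
    f (∑ m ∈ F, a m • stdBasis m) = ∑ m ∈ F, σ m (a m) • f (stdBasis m) := by
  have key : ∀ G ⊆ F, f (∑ m ∈ F, a m • stdBasis m)
      - f (∑ m ∈ F, (if m ∈ G then -a m else a m) • stdBasis m)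
      = (2 : ℂ) • ∑ m ∈ G, σ m (a m) • f (stdBasis m) := by
    intro G
    induction G using Finset.induction_on with
    | empty => simp
    | insert n G hnG ih =>
      intro hG
      have hnF : n ∈ F := hG (Finset.mem_insert_self n G)
      have h := hf.map_sum_sub_map_sum_update (F := F)
        (a := fun m => if m ∈ G then -a m else a m)
        (b := fun m => if m ∈ insert n G then -a m else a m) (n := n)
        (fun m hm => by split_ifs <;> simp [ha m hm]) hnF (by simp [hnG])
        (fun m _ hmn => by simp [hmn])
      rw [Finset.sum_insert hnG, smul_add,
        ← ih ((Finset.subset_insert n G).trans hG), ← sub_add_sub_cancel', h]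
      simp only [hnG, if_false]
  have h := key F subset_rfl
  have h1 : ∑ m ∈ F, (if m ∈ F then -a m else a m) • (stdBasis m : C₀(Γ, ℂ))
      = -∑ m ∈ F, a m • stdBasis m := by
    rw [← Finset.sum_neg_distrib]
    exact Finset.sum_congr rfl fun m hm => by rw [if_pos hm, neg_smul_stdBasis]
  rw [h1, hf.map_neg (norm_sum_smul_stdBasis hF ha), sub_neg_eq_add, ← two_smul ℂ] at h
  exact smul_right_injective X (two_ne_zero' ℂ) h

/-- Complete M-orthogonality of the images of the basis vectors, upper bound. -/
theorem norm_sum_le_one (hf : IsSphereIsometry f σ) {F : Finset Γ} {a : Γ → ℂ}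
    (ha : ∀ m ∈ F, ‖a m‖ ≤ 1) : ‖∑ m ∈ F, σ m (a m) • f (stdBasis m)‖ ≤ 1 := by
  rcases F.eq_empty_or_nonempty with rfl | hF
  · simp
  have : ∀ m, ∃ b c : ℂ, m ∈ F → ‖b‖ = 1 ∧ ‖c‖ = 1 ∧ b + c = 2 * a m := fun m => by
    by_cases hm : m ∈ F
    · obtain ⟨b, c, h⟩ := Complex.exists_norm_eq_one_add_eq_two_mul (ha m hm)
      exact ⟨b, c, fun _ => h⟩
    · exact ⟨0, 0, fun h => absurd h hm⟩
  choose b c hbc using this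
  have hone : ∀ d : Γ → ℂ, (∀ m ∈ F, ‖d m‖ = 1) →
      ‖∑ m ∈ F, σ m (d m) • f (stdBasis m)‖ = 1 := fun d hd => by
    rw [← hf.map_sum_of_norm_eq_one hF hd, hf.norm_map _ (norm_sum_smul_stdBasis hF hd)]
  have hsum : (2 : ℂ) • ∑ m ∈ F, σ m (a m) • f (stdBasis m)
      = ∑ m ∈ F, σ m (b m) • f (stdBasis m) + ∑ m ∈ F, σ m (c m) • f (stdBasis m) := by
    rw [Finset.smul_sum, ← Finset.sum_add_distrib]
    refine Finset.sum_congr rfl fun m hm => ?_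
    rw [← add_smul, ← map_add, (hbc m hm).2.2, two_mul, map_add, two_smul, add_smul]
  have h := norm_add_le (∑ m ∈ F, σ m (b m) • f (stdBasis m)) (∑ m ∈ F, σ m (c m) • f (stdBasis m))
  rw [← hsum, norm_smul, hone b fun m hm => (hbc m hm).1, hone c fun m hm => (hbc m hm).2.1] at h
  norm_num at h
  linarith

theorem norm_sum_le (hf : IsSphereIsometry f σ) {F : Finset Γ} {a : Γ → ℂ} {M : ℝ} (hM : 0 < M)
    (ha : ∀ m ∈ F, ‖a m‖ ≤ M) : ‖∑ m ∈ F, σ m (a m) • f (stdBasis m)‖ ≤ M := by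
  have h := hf.norm_sum_le_one (F := F) (a := fun m => M⁻¹ • a m) fun m hm => by
    rw [norm_smul, norm_inv, Real.norm_of_nonneg hM.le]
    exact inv_mul_le_one_of_le₀ (ha m hm) hM.le
  simp only [LinearIsometryEquiv.map_smul, smul_assoc] at h
  rwa [← Finset.smul_sum, norm_smul, norm_inv, Real.norm_of_nonneg hM.le, inv_mul_le_one₀ hM] at h

/-- Complete M-orthogonality of the images of the basis vectors. -/
theorem norm_sum_eq (hf : IsSphereIsometry f σ) {F : Finset Γ} {a : Γ → ℂ} {n : Γ} (hn : n ∈ F)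
    (han : a n ≠ 0) (ha : ∀ m ∈ F, ‖a m‖ ≤ ‖a n‖) :
    ‖∑ m ∈ F, σ m (a m) • f (stdBasis m)‖ = ‖a n‖ := by
  have hpos := norm_pos_iff.2 han
  refine le_antisymm (hf.norm_sum_le hpos ha) ?_
  have hb := hf.norm_sum_le (F := F) (a := fun m => if m = n then a m else -a m) hpos
    fun m hm => by
      split_ifs
      · exact ha m hm
      · rw [norm_neg]; exact ha m hm
  have hsum : ∑ m ∈ F, σ m (a m) • f (stdBasis m)
      + ∑ m ∈ F, σ m (if m = n then a m else -a m) • f (stdBasis m)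
      = (2 : ℂ) • (σ n (a n) • f (stdBasis n)) := by
    rw [← Finset.sum_add_distrib, Finset.sum_eq_single_of_mem n hn]
    · rw [if_pos rfl, two_smul]
    · intro m _ hmn
      rw [if_neg hmn, _root_.map_neg, neg_smul, add_neg_cancel]
  have h := norm_add_le (∑ m ∈ F, σ m (a m) • f (stdBasis m))
    (∑ m ∈ F, σ m (if m = n then a m else -a m) • f (stdBasis m))
  rw [hsum, norm_smul, norm_smul, LinearIsometryEquiv.norm_map,
    hf.norm_map _ (norm_stdBasis n)] at h
  norm_num at h
  linarith

theorem map_sum (hf : IsSphereIsometry f σ) {F : Finset Γ} {a : Γ → ℂ}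
    (ha : ∀ m ∈ F, ‖a m‖ ≤ 1) (hmax : ∃ m ∈ F, ‖a m‖ = 1) :
    f (∑ m ∈ F, a m • stdBasis m) = ∑ m ∈ F, σ m (a m) • f (stdBasis m) := by
  obtain ⟨n, hn, han⟩ := hmax
  have hw : ‖∑ m ∈ F, σ m (a m) • f (stdBasis m)‖ = 1 := by
    rw [hf.norm_sum_eq hn (norm_ne_zero_iff.1 (by simp [han])) (by simpa [han] using ha), han]
  obtain ⟨x, hx1, hx⟩ := hf.exists_eq _ hw
  rw [← hx]
  congr 1
  have hs : ‖∑ m ∈ F, a m • (stdBasis m : C₀(Γ, ℂ))‖ ≤ 1 :=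
    (norm_le_iff _ zero_le_one).2 fun m => by
      rw [sum_smul_stdBasis_apply]
      split_ifs with h
      · exact ha m h
      · simp
  refine eq_of_forall_max_norm_sub_smul_stdBasis_eq hs hx1.le fun i c hc => ?_
  rw [max_norm_sub_smul_stdBasis hs, sum_smul_stdBasis_apply, ← hf.norm_sub_smul hx1 i hc, hx]
  set b : Γ → ℂ := fun m => (if m ∈ F then a m else 0) - if m = i then c else 0 with hb
  have hbi : b i = (if i ∈ F then a i else 0) - c := by simp [hb]
  have hbm : ∀ m, m ≠ i → ‖b m‖ ≤ 1 := fun m hm => by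
    by_cases h : m ∈ F
    · simpa [hb, hm, h] using ha m h
    · simp [hb, hm, h]
  have hsum : ∑ m ∈ F, σ m (a m) • f (stdBasis m) - σ i c • f (stdBasis i)
      = ∑ m ∈ insert i F, σ m (b m) • f (stdBasis m) := by
    simp only [hb, map_sub, sub_smul, Finset.sum_sub_distrib]
    congr 1
    · refine Finset.sum_subset_zero_on_sdiff (Finset.subset_insert i F) ?_ ?_
      · intro m hm
        simp [(Finset.mem_sdiff.1 hm).2]
      · intro m hm
        simp [hm]
    · rw [Finset.sum_eq_single_of_mem i (Finset.mem_insert_self i F)]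
      · simp
      · intro m _ hm
        simp [hm]
  rw [hsum, ← hbi]
  rcases le_or_gt ‖b i‖ 1 with h | h
  · rw [max_eq_right h, max_eq_right]
    refine hf.norm_sum_le_one fun m _ => ?_
    by_cases hm : m = i
    · rwa [hm]
    · exact hbm m hm
  · rw [hf.norm_sum_eq (Finset.mem_insert_self i F)
      (norm_pos_iff.1 (zero_lt_one.trans h)) fun m _ => ?_]
    by_cases hm : m = i
    · rw [hm]
    · exact (hbm m hm).trans h.le

end IsSphereIsometry

/-- If `σₙ` (the identity or complex conjugation) satisfies `Δ(λ eₙ) = σₙ(λ) Δ(eₙ)` for all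
unimodular `λ`, then for distinct coordinates `n₁, …, n_k` and nonzero scalars `λ₁, …, λ_k`
with `max |λⱼ| = 1` one has `Δ(∑ λⱼ e_{n_j}) = ∑ σ_{n_j}(λⱼ) Δ(e_{n_j})`. -/
theorem image_of_finitely_supported {Γ : Type*} [TopologicalSpace Γ]
    [DiscreteTopology Γ] [DecidableEq Γ] [Infinite Γ]
    {X : Type*} [NormedAddCommGroup X] [NormedSpace ℂ X] [CompleteSpace X]
    (Δ : sphere (0 : C₀(Γ, ℂ)) 1 → sphere (0 : X) 1)
    (hΔiso : Isometry Δ) (hΔsurj : Function.Surjective Δ)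
    (σ : Γ → ℂ → ℂ) (hσ : ∀ n, σ n = id ∨ σ n = fun z => (starRingEnd ℂ) z)
    (hΔσ : ∀ (n : Γ) (lam : ℂ), ‖lam‖ = 1 →
      ∀ x y : sphere (0 : C₀(Γ, ℂ)) 1, (x : C₀(Γ, ℂ)) = lam • stdBasis n →
        (y : C₀(Γ, ℂ)) = stdBasis n → (Δ x : X) = σ n lam • (Δ y : X))
    (k : ℕ) (n : Fin k → Γ) (hn : Function.Injective n)
    (lam : Fin k → ℂ) (hlam0 : ∀ j, lam j ≠ 0)
    (hlam_le : ∀ j, ‖lam j‖ ≤ 1) (hlam_max : ∃ j, ‖lam j‖ = 1)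
    (s : sphere (0 : C₀(Γ, ℂ)) 1) (hs : (s : C₀(Γ, ℂ)) = ∑ j, lam j • stdBasis (n j))
    (y : Fin k → sphere (0 : C₀(Γ, ℂ)) 1) (hy : ∀ j, (y j : C₀(Γ, ℂ)) = stdBasis (n j)) :
    (Δ s : X) = ∑ j, σ (n j) (lam j) • (Δ (y j) : X) := by
  have hσ' : ∀ m, ∃ S : ℂ ≃ₗᵢ[ℝ] ℂ, ∀ z, S z = σ m z := fun m => by
    rcases hσ m with h | h
    · exact ⟨LinearIsometryEquiv.refl ℝ ℂ, fun z => by simp [h]⟩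
    · exact ⟨Complex.conjLIE, fun z => by simp [h]⟩
  choose S hS using hσ'
  classical
  set f : C₀(Γ, ℂ) → X := fun x => if h : x ∈ sphere (0 : C₀(Γ, ℂ)) 1 then Δ ⟨x, h⟩ else 0 with hfdef
  have hfΔ : ∀ x : sphere (0 : C₀(Γ, ℂ)) 1, f x = Δ x := fun x => by
    simp only [hfdef, x.2, dif_pos]
  have hf : IsSphereIsometry f S := by
    constructor
    · intro x hx
      have := hfΔ ⟨x, mem_sphere_zero_iff_norm.2 hx⟩
      rw [this]
      exact mem_sphere_zero_iff_norm.1 (Δ _).2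
    · intro x z hx hz
      rw [hfΔ ⟨x, mem_sphere_zero_iff_norm.2 hx⟩, hfΔ ⟨z, mem_sphere_zero_iff_norm.2 hz⟩,
        ← dist_eq_norm, ← dist_eq_norm]
      exact hΔiso.dist_eq _ _
    · intro w hw
      obtain ⟨x, hx⟩ := hΔsurj ⟨w, mem_sphere_zero_iff_norm.2 hw⟩
      exact ⟨x, mem_sphere_zero_iff_norm.1 x.2, by rw [hfΔ, hx]⟩
    · intro m c hc
      have hc' := mem_sphere_zero_iff_norm.2 ((norm_smul_stdBasis m c).trans hc)
      have h1 := mem_sphere_zero_iff_norm.2 (IsSphereIsometry.norm_stdBasis m)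
      rw [hfΔ ⟨_, hc'⟩, hfΔ ⟨_, h1⟩, hS]
      exact hΔσ m c hc _ _ rfl rfl
  have hk : ∀ j, Function.extend n lam 0 (n j) = lam j := fun j => hn.extend_apply lam 0 j
  have h := hf.map_sum (F := Finset.univ.map ⟨n, hn⟩) (a := Function.extend n lam 0)
    (by simpa [hk] using hlam_le) (by simpa [hk] using hlam_max)
  simp only [Finset.sum_map, Function.Embedding.coeFn_mk, hk, hS] at h
  rw [← hs, hfΔ] at h
  rw [h]
  exact Finset.sum_congr rfl fun j _ => by rw [← hfΔ, hy]
end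

section
/- Let Γ be an infinite set and X a complex Banach space. Every surjective isometry Δ : S(c₀(Γ)) → S(X) between the unit spheres admits a unique extension to a surjective real-linear isometry F : c₀(Γ) → X. In particular, c₀(Γ) satisfies the Mazur-Ulam property and X is isometrically (real-linearly) isomorphic to c₀(Γ). -/
open ZeroAtInfty Metric

namespace ZeroAtInftyContinuousMap

variable {Γ : Type*} [TopologicalSpace Γ]

theorem norm_apply_le_norm (x : C₀(Γ, ℂ)) (k : Γ) : ‖x k‖ ≤ ‖x‖ := by
  rw [← norm_toBCF_eq_norm]
  exact x.toBCF.norm_coe_le_norm k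

theorem norm_le_of_forall_apply_le {x : C₀(Γ, ℂ)} {c : ℝ} (hc : 0 ≤ c)
    (h : ∀ k, ‖x k‖ ≤ c) : ‖x‖ ≤ c := by
  rw [← norm_toBCF_eq_norm]
  exact (BoundedContinuousFunction.norm_le hc).2 h

variable [DiscreteTopology Γ]

theorem exists_norm_apply_eq_norm {x : C₀(Γ, ℂ)} (hx : 0 < ‖x‖) : ∃ k, ‖x k‖ = ‖x‖ := by
  have hfin : {k | ‖x‖ / 2 ≤ ‖x k‖}.Finite := by
    have h := x.zero_at_infty'.norm
    rw [norm_zero, Filter.cocompact_eq_cofinite] at h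
    have h' := h.eventually_lt_const (half_pos hx)
    rw [Filter.eventually_cofinite] at h'
    simpa using h'
  by_cases hne : {k | ‖x‖ / 2 ≤ ‖x k‖}.Nonempty
  · obtain ⟨k, hk, hmax⟩ := hfin.exists_maximalFor (fun k => ‖x k‖) _ hne
    refine ⟨k, le_antisymm (norm_apply_le_norm x k)
      (norm_le_of_forall_apply_le (norm_nonneg _) fun j => ?_)⟩
    by_cases hj : ‖x‖ / 2 ≤ ‖x j‖
    · exact (le_total ‖x j‖ ‖x k‖).elim id fun h => hmax hj h
    · exact (not_le.1 hj).le.trans hk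
  · have : ‖x‖ ≤ ‖x‖ / 2 := norm_le_of_forall_apply_le (by positivity) fun j => by
      by_contra hj
      exact hne ⟨j, (not_le.1 hj).le⟩
    linarith

open Classical in
/-- The function obtained from `x` by changing its value at `k` to `a`. -/
noncomputable def update (x : C₀(Γ, ℂ)) (k : Γ) (a : ℂ) : C₀(Γ, ℂ) where
  toFun := Function.update x k a
  continuous_toFun := continuous_of_discreteTopology
  zero_at_infty' := by
    refine x.zero_at_infty'.congr' ?_
    rw [Filter.cocompact_eq_cofinite]
    filter_upwards [(Set.finite_singleton k).compl_mem_cofinite] with j hj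
    exact (Function.update_of_ne hj _ _).symm

@[simp]
theorem update_apply_self (x : C₀(Γ, ℂ)) (k : Γ) (a : ℂ) : x.update k a k = a := by
  classical exact Function.update_self k a x

theorem update_apply_of_ne (x : C₀(Γ, ℂ)) {j k : Γ} (h : j ≠ k) (a : ℂ) :
    x.update k a j = x j := by
  classical exact Function.update_of_ne h a x

theorem norm_update_eq_one {x : C₀(Γ, ℂ)} (hx : ‖x‖ ≤ 1) (k : Γ) {a : ℂ} (ha : ‖a‖ = 1) :
    ‖x.update k a‖ = 1 := by
  apply le_antisymm
  · refine norm_le_of_forall_apply_le zero_le_one fun j => ?_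
    by_cases h : j = k
    · subst h; simp [ha]
    · rw [update_apply_of_ne _ h]; exact (norm_apply_le_norm x j).trans hx
  · simpa [ha] using norm_apply_le_norm (x.update k a) k

theorem norm_sub_update_le (x : C₀(Γ, ℂ)) (k : Γ) (a : ℂ) :
    ‖x - x.update k a‖ ≤ ‖x k - a‖ := by
  refine norm_le_of_forall_apply_le (norm_nonneg _) fun j => ?_
  by_cases h : j = k
  · subst h; simp
  · simp [update_apply_of_ne _ h]

theorem norm_sub_eq_two_iff {x y : C₀(Γ, ℂ)} (hx : ‖x‖ = 1) (hy : ‖y‖ = 1) :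
    ‖x - y‖ = 2 ↔ ∃ k, ‖x k‖ = 1 ∧ y k = -x k := by
  constructor
  · intro h
    obtain ⟨k, hk⟩ := exists_norm_apply_eq_norm (x := x - y) (by rw [h]; norm_num)
    rw [h, sub_apply] at hk
    have h1 := hx ▸ norm_apply_le_norm x k
    have h2 := hy ▸ norm_apply_le_norm y k
    have h3 := norm_sub_le (x k) (y k)
    have hp := parallelogram_law_with_norm ℝ (x k) (y k)
    have h4 : ‖x k‖ = 1 := by linarith
    have h5 : ‖y k‖ = 1 := by linarith
    rw [hk, h4, h5] at hp
    have h6 : ‖x k + y k‖ = 0 := by nlinarith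
    exact ⟨k, h4, eq_neg_of_add_eq_zero_right (norm_eq_zero.1 h6)⟩
  · rintro ⟨k, h1, h2⟩
    apply le_antisymm
    · linarith [norm_sub_le x y]
    · have h := norm_apply_le_norm (x - y) k
      rw [sub_apply, h2, sub_neg_eq_add, ← two_mul, norm_mul, h1] at h
      simpa using h

theorem apply_eq_neg_of_norm_sub_update {y : C₀(Γ, ℂ)} {k : Γ} {ν : ℂ} (hν : ‖ν‖ = 1)
    (hy : ‖y‖ = 1) (h : ‖(0 : C₀(Γ, ℂ)).update k ν - y‖ = 2) : y k = -ν := by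
  obtain ⟨j, hj, hyj⟩ := (norm_sub_eq_two_iff (norm_update_eq_one (by simp) k hν) hy).1 h
  by_cases hjk : j = k
  · subst hjk; simpa using hyj
  · rw [update_apply_of_ne _ hjk] at hj
    simp at hj

end ZeroAtInftyContinuousMap

open ZeroAtInftyContinuousMap

theorem Complex.norm_add_le_of_norm_eq_one {ν w : ℂ} (hν : ‖ν‖ = 1) :
    ‖w + ν‖ ≤ 1 + ((starRingEnd ℂ) ν * w).re + ‖w‖ ^ 2 / 2 := by
  have h1 : ‖w + ν‖ ^ 2 = ‖w‖ ^ 2 + 1 + 2 * ((starRingEnd ℂ) ν * w).re := by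
    have hn : ν.re ^ 2 + ν.im ^ 2 = 1 := by
      have := Complex.sq_norm ν
      rw [hν, Complex.normSq_apply] at this
      linarith
    simp only [Complex.sq_norm, Complex.normSq_apply, Complex.add_re, Complex.add_im,
      Complex.mul_re, Complex.conj_re, Complex.conj_im]
    linarith
  nlinarith [sq_nonneg (‖w + ν‖ - 1)]

/-- A real-linear functional on `ℂ` lying below `ν ↦ ‖z + ν‖ - 1` on the unit circle is the
one represented by `z`. -/
theorem Complex.eq_of_forall_re_conj_mul_le {z w : ℂ}
    (h : ∀ ν : ℂ, ‖ν‖ = 1 → ((starRingEnd ℂ) ν * w).re ≤ ‖z + ν‖ - 1) (hz : ‖z‖ ≤ 1) :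
    w = z := by
  obtain ⟨α, hα, hzα⟩ : ∃ α : ℂ, ‖α‖ = 1 ∧ z = ‖z‖ * α := by
    by_cases hz0 : z = 0
    · exact ⟨1, by simp, by simp [hz0]⟩
    · exact ⟨z / ‖z‖, by simp [hz0], by field_simp [norm_ne_zero_iff.2 hz0]⟩
  set ρ := ‖z‖ with hρ
  have hρ0 : 0 ≤ ρ := norm_nonneg z
  have hαα : (starRingEnd ℂ) α * α = 1 := by
    rw [mul_comm, Complex.mul_conj, Complex.normSq_eq_norm_sq, hα]; simp
  set v := (starRingEnd ℂ) α * w with hv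
  have hw : w = α * v := by rw [hv, ← mul_assoc, mul_comm α, hαα, one_mul]
  have key : ∀ q : ℝ, ∀ c d : ℝ, c ^ 2 + d ^ 2 = 1 → 0 ≤ q → 1 + 2 * ρ * c + ρ ^ 2 ≤ q ^ 2 →
      c * v.re + d * v.im ≤ q - 1 := by
    intro q c d hcd hq hle
    have h1 := h (α * ⟨c, d⟩) (by
      rw [norm_mul, hα, one_mul, Complex.norm_def, Complex.normSq_mk]
      rw [show c * c + d * d = 1 by linarith, Real.sqrt_one])
    have h2 : ‖z + α * ⟨c, d⟩‖ ≤ q := by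
      rw [hzα, mul_comm (ρ : ℂ), ← mul_add, norm_mul, hα, one_mul]
      refine abs_le_of_sq_le_sq' ?_ hq |>.2
      rw [Complex.sq_norm, Complex.normSq_apply]
      simp
      nlinarith
    have h3 : ((starRingEnd ℂ) (α * ⟨c, d⟩) * w).re = c * v.re + d * v.im := by
      rw [map_mul, mul_right_comm, ← hv]
      simp
      ring
    linarith
  have hre : v.re = ρ := by
    have h1 := key (1 + ρ) 1 0 (by norm_num) (by positivity) (by nlinarith)
    have h2 := key (1 - ρ) (-1) 0 (by norm_num) (by linarith) (by nlinarith)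
    linarith
  have him : ∀ q : ℝ, q ≠ 0 → 2 * q * v.im ≤ 2 * q ^ 2 := by
    intro q hq
    have hq1 : 0 < 1 + q ^ 2 := by positivity
    set e := 2 * q ^ 2 / (1 + q ^ 2) with he
    have he0 : 0 ≤ e := by positivity
    have he2 : e ≤ 2 := by rw [he, div_le_iff₀ hq1]; nlinarith
    have hρe : ρ * e / (1 + ρ) ≤ 1 + ρ := by
      rw [div_le_iff₀ (by positivity)]; nlinarith
    have h1 := key (1 + ρ - ρ * e / (1 + ρ)) (1 - e) (2 * q / (1 + q ^ 2))
      (by rw [he]; field_simp; ring) (by linarith)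
      (by
        have : (1 + ρ) * (ρ * e / (1 + ρ)) = ρ * e := by field_simp
        nlinarith [sq_nonneg (ρ * e / (1 + ρ))])
    have h2 : ρ * e - ρ * e / (1 + ρ) ≤ e := by
      have : ρ * e - ρ * e / (1 + ρ) = (ρ * ρ) * e / (1 + ρ) := by field_simp; ring
      rw [this, div_le_iff₀ (by positivity)]
      nlinarith [mul_nonneg hρ0 he0]
    rw [hre] at h1
    have h3 : 2 * q / (1 + q ^ 2) * v.im ≤ e := by linarith
    rw [he, div_mul_eq_mul_div, div_le_div_iff_of_pos_right hq1] at h3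
    exact h3
  have him0 : v.im = 0 := by
    apply le_antisymm
    · refine le_of_forall_pos_le_add fun q hq => ?_
      have := him q hq.ne'
      nlinarith
    · refine le_of_forall_pos_le_add fun q hq => ?_
      have := him (-q) (by simpa using hq.ne')
      nlinarith
  have hvρ : v = ρ := Complex.ext (by simpa using hre) (by simpa using him0)
  rw [hw, hvρ, hzα, mul_comm]

section SphereIsometry

variable {Γ : Type*} [TopologicalSpace Γ]
  {X : Type*} [NormedAddCommGroup X]

/-- `G` restricts to a surjective isometry between the unit spheres. -/
structure IsSphereIsometry_s16 (G : C₀(Γ, ℂ) → X) : Prop where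
  norm_map : ∀ x, ‖x‖ = 1 → ‖G x‖ = 1
  norm_map_sub : ∀ x y, ‖x‖ = 1 → ‖y‖ = 1 → ‖G x - G y‖ = ‖x - y‖
  exists_map_eq : ∀ u, ‖u‖ = 1 → ∃ x, ‖x‖ = 1 ∧ G x = u

/-- `φ` is a contractive real functional with value one on the image under `G` of the maximal
face `{x | ‖x‖ = 1 ∧ x k = ν}` of the unit ball. -/
structure SupportsFace [NormedSpace ℝ X] (G : C₀(Γ, ℂ) → X) (φ : X →L[ℝ] ℝ) (k : Γ) (ν : ℂ) :
    Prop where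
  le_norm : ∀ u, φ u ≤ ‖u‖
  map_eq_one : ∀ x, ‖x‖ = 1 → x k = ν → φ (G x) = 1

namespace IsSphereIsometry_s16

variable [DiscreteTopology Γ] {G : C₀(Γ, ℂ) → X}

theorem norm_sub_eq_two_of_apply_eq_neg (hG : IsSphereIsometry_s16 G) {x y : C₀(Γ, ℂ)} {k : Γ}
    (hx : ‖x‖ = 1) (hy : ‖y‖ = 1) (hxk : ‖x k‖ = 1) (hxy : y k = -x k) : ‖G x - G y‖ = 2 := by
  rw [hG.norm_map_sub x y hx hy]
  exact (norm_sub_eq_two_iff hx hy).2 ⟨k, hxk, hxy⟩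

variable [NormedSpace ℝ X]

theorem exists_map_eq_neg (hG : IsSphereIsometry_s16 G) {x : C₀(Γ, ℂ)} {k : Γ} {ν : ℂ} (hν : ‖ν‖ = 1)
    (hx : ‖x‖ = 1) (hxk : x k = ν) : ∃ y, ‖y‖ = 1 ∧ y k = -ν ∧ G y = -G x := by
  have he := norm_update_eq_one (x := (0 : C₀(Γ, ℂ))) (by simp) k hν
  obtain ⟨v, hv, hGv⟩ := hG.exists_map_eq (-G ((0 : C₀(Γ, ℂ)).update k ν))
    (by rw [norm_neg, hG.norm_map _ he])
  have hvk : v k = -ν := by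
    apply apply_eq_neg_of_norm_sub_update hν hv
    rw [← hG.norm_map_sub _ _ he hv, hGv, sub_neg_eq_add, ← two_smul ℝ, norm_smul,
      hG.norm_map _ he]
    norm_num
  obtain ⟨y, hy, hGy⟩ := hG.exists_map_eq (-G x) (by rw [norm_neg, hG.norm_map _ hx])
  refine ⟨y, hy, ?_, hGy⟩
  apply apply_eq_neg_of_norm_sub_update hν hy
  have h := hG.norm_sub_eq_two_of_apply_eq_neg hx hv (by rw [hxk, hν]) (by rw [hvk, hxk])
  rw [hGv, sub_neg_eq_add] at h
  rw [← hG.norm_map_sub _ _ he hy, hGy, sub_neg_eq_add, add_comm, h]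

theorem norm_map_add (hG : IsSphereIsometry_s16 G) {x y : C₀(Γ, ℂ)} {k : Γ} {ν : ℂ} (hν : ‖ν‖ = 1)
    (hx : ‖x‖ = 1) (hy : ‖y‖ = 1) (hxk : x k = ν) (hyk : y k = ν) : ‖G x + G y‖ = 2 := by
  obtain ⟨z, hz, hzk, hGz⟩ := hG.exists_map_eq_neg hν hy hyk
  rw [← sub_neg_eq_add, ← hGz]
  exact hG.norm_sub_eq_two_of_apply_eq_neg hx hz (by rw [hxk, hν]) (by rw [hzk, hxk])

theorem norm_combination (hG : IsSphereIsometry_s16 G) {x y : C₀(Γ, ℂ)} {k : Γ} {ν : ℂ} (hν : ‖ν‖ = 1)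
    (hx : ‖x‖ = 1)
    (hy : ‖y‖ = 1) (hxk : x k = ν) (hyk : y k = ν) {s t : ℝ} (hs : 0 ≤ s) (ht : 0 ≤ t)
    (hst : s + t = 1) : ‖s • G x + t • G y‖ = 1 := by
  have hle : ∀ a b : ℝ, 0 ≤ a → 0 ≤ b → a + b = 1 → ‖a • G x + b • G y‖ ≤ 1 := by
    intro a b ha hb hab
    refine (norm_add_le _ _).trans ?_
    rw [norm_smul, norm_smul, hG.norm_map _ hx, hG.norm_map _ hy, Real.norm_of_nonneg ha,
      Real.norm_of_nonneg hb]
    linarith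
  have h2 := hG.norm_map_add hν hx hy hxk hyk
  have hsum : G x + G y = (s • G x + t • G y) + (t • G x + s • G y) := by
    calc G x + G y = (s + t) • G x + (s + t) • G y := by rw [hst, one_smul, one_smul]
      _ = _ := by module
  have h3 := norm_add_le (s • G x + t • G y) (t • G x + s • G y)
  rw [← hsum, h2] at h3
  linarith [hle s t hs ht hst, hle t s ht hs (by linarith)]

theorem exists_map_eq_combination_of_lt (hG : IsSphereIsometry_s16 G) {x y : C₀(Γ, ℂ)} {k : Γ} {ν : ℂ}
    (hν : ‖ν‖ = 1) (hx : ‖x‖ = 1) (hy : ‖y‖ = 1) (hxk : x k = ν) (hyk : y k = ν)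
    (hlt : ∀ j, j ≠ k → ‖x j‖ < 1) {s t : ℝ} (hs : 0 < s) (ht : 0 ≤ t) (hst : s + t = 1) :
    ∃ z, ‖z‖ = 1 ∧ z k = ν ∧ G z = s • G x + t • G y := by
  obtain ⟨z, hz, hGz⟩ := hG.exists_map_eq _ (hG.norm_combination hν hx hy hxk hyk hs.le ht hst)
  refine ⟨z, hz, ?_, hGz⟩
  obtain ⟨j, hj⟩ := exists_norm_apply_eq_norm (x := z) (by rw [hz]; exact one_pos)
  rw [hz] at hj
  have hj' : ‖-z j‖ = 1 := by rwa [norm_neg]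
  set w := (0 : C₀(Γ, ℂ)).update j (-z j) with hw
  have hw1 : ‖w‖ = 1 := norm_update_eq_one (by simp) j hj'
  have hwz := hG.norm_sub_eq_two_of_apply_eq_neg hw1 hz (k := j) (by simp [hw, hj])
    (by simp [hw])
  have hdecomp : G w - G z = s • (G w - G x) + t • (G w - G y) := by
    rw [hGz]
    calc _ = (s + t) • G w - (s • G x + t • G y) := by rw [hst, one_smul]
      _ = _ := by module
  have h1 : ‖G w - G x‖ ≤ 2 := by
    linarith [norm_sub_le (G w) (G x), hG.norm_map _ hw1, hG.norm_map _ hx]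
  have h2 : ‖G w - G y‖ ≤ 2 := by
    linarith [norm_sub_le (G w) (G y), hG.norm_map _ hw1, hG.norm_map _ hy]
  have h3 := norm_add_le (s • (G w - G x)) (t • (G w - G y))
  rw [← hdecomp, hwz, norm_smul, norm_smul, Real.norm_of_nonneg hs.le,
    Real.norm_of_nonneg ht] at h3
  have h4 : ‖G w - G x‖ = 2 := by nlinarith
  rw [hG.norm_map_sub _ _ hw1 hx] at h4
  have h5 := apply_eq_neg_of_norm_sub_update hj' hx h4
  rw [neg_neg] at h5
  by_cases hjk : j = k
  · subst hjk; rw [← h5, hxk]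
  · have := hlt j hjk
    rw [h5, hj] at this
    exact absurd this (lt_irrefl _)

theorem exists_map_eq_combination (hG : IsSphereIsometry_s16 G) {x y : C₀(Γ, ℂ)} {k : Γ} {ν : ℂ}
    (hν : ‖ν‖ = 1) (hx : ‖x‖ = 1) (hy : ‖y‖ = 1) (hxk : x k = ν) (hyk : y k = ν)
    {s t : ℝ} (hs : 0 ≤ s) (ht : 0 ≤ t) (hst : s + t = 1) :
    ∃ z, ‖z‖ = 1 ∧ z k = ν ∧ G z = s • G x + t • G y := by
  rcases hs.eq_or_lt with rfl | hs
  · exact ⟨y, hy, hyk, by rw [show t = 1 by linarith]; simp⟩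
  obtain ⟨z, hz, hGz⟩ := hG.exists_map_eq _ (hG.norm_combination hν hx hy hxk hyk hs.le ht hst)
  refine ⟨z, hz, ?_, hGz⟩
  have hν' : ‖-ν‖ = 1 := by rwa [norm_neg]
  set e := (0 : C₀(Γ, ℂ)).update k (-ν) with he
  have he1 : ‖e‖ = 1 := norm_update_eq_one (by simp) k hν'
  suffices h : ‖e - z‖ = 2 by simpa using apply_eq_neg_of_norm_sub_update hν' hz h
  apply le_antisymm (by linarith [norm_sub_le e z])
  refine le_of_forall_pos_le_add fun ε hε => ?_
  obtain ⟨δ, hδ0, hδ1, hδε⟩ : ∃ δ : ℝ, 0 < δ ∧ δ ≤ 1 ∧ 2 * δ ≤ ε :=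
    ⟨min 1 (ε / 2), by positivity, min_le_left _ _, by linarith [min_le_right 1 (ε / 2)]⟩
  set p : C₀(Γ, ℂ) := (((1 - δ : ℝ) : ℂ) • x).update k ν with hp
  have hxδ : ‖((1 - δ : ℝ) : ℂ) • x‖ ≤ 1 - δ := by
    rw [norm_smul, hx, Complex.norm_of_nonneg (by linarith), mul_one]
  have hp1 : ‖p‖ = 1 := norm_update_eq_one (hxδ.trans (by linarith)) k hν
  have hpx : ‖p - x‖ ≤ δ := by
    refine norm_le_of_forall_apply_le hδ0.le fun j => ?_
    by_cases hjk : j = k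
    · subst hjk; simp [hp, hxk, hδ0.le]
    · rw [ZeroAtInftyContinuousMap.sub_apply, hp, update_apply_of_ne _ hjk,
        ZeroAtInftyContinuousMap.smul_apply, smul_eq_mul]
      rw [show ((1 - δ : ℝ) : ℂ) * x j - x j = -(δ * x j) by push_cast; ring, norm_neg,
        norm_mul, Complex.norm_of_nonneg hδ0.le]
      nlinarith [norm_apply_le_norm x j]
  obtain ⟨q, hq, hqk, hGq⟩ := hG.exists_map_eq_combination_of_lt hν hp1 hy (by simp [hp]) hyk
    (fun j hjk => by
      rw [hp, update_apply_of_ne _ hjk]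
      linarith [norm_apply_le_norm (((1 - δ : ℝ) : ℂ) • x) j]) hs ht hst
  have h1 := hG.norm_sub_eq_two_of_apply_eq_neg he1 hq (k := k) (by simp [he, hν])
    (by simp [he, hqk])
  have h2 : ‖G q - G z‖ ≤ δ := by
    rw [hGq, hGz, add_sub_add_right_eq_sub, ← smul_sub, norm_smul, Real.norm_of_nonneg hs.le,
      hG.norm_map_sub _ _ hp1 hx]
    nlinarith [norm_nonneg (p - x)]
  have h3 := norm_sub_le_norm_sub_add_norm_sub (G e) (G z) (G q)
  rw [norm_sub_rev (G z), hG.norm_map_sub _ _ he1 hz, h1] at h3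
  linarith

theorem exists_supportsFace (hG : IsSphereIsometry_s16 G) (k : Γ) {ν : ℂ} (hν : ‖ν‖ = 1) :
    ∃ φ : X →L[ℝ] ℝ, SupportsFace G φ k ν := by
  have hconv : Convex ℝ {u | ∃ x, ‖x‖ = 1 ∧ x k = ν ∧ G x = u} := by
    rintro _ ⟨x, hx, hxk, rfl⟩ _ ⟨y, hy, hyk, rfl⟩ s t hs ht hst
    exact hG.exists_map_eq_combination hν hx hy hxk hyk hs ht hst
  have hdisj : Disjoint (ball (0 : X) 1) {u | ∃ x, ‖x‖ = 1 ∧ x k = ν ∧ G x = u} := by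
    rw [Set.disjoint_left]
    rintro _ hu ⟨x, hx, -, rfl⟩
    rw [mem_ball_zero_iff, hG.norm_map x hx] at hu
    exact lt_irrefl _ hu
  obtain ⟨f, c, hf, hc⟩ := geometric_hahn_banach_open (convex_ball 0 1) isOpen_ball hconv hdisj
  have hc0 : 0 < c := by simpa using hf 0 (by simp)
  have hle : ∀ u, f u ≤ c * ‖u‖ := by
    intro u
    refine le_of_forall_pos_le_add fun ε hε => ?_
    have hr : 0 < ‖u‖ + ε / c := by positivity
    have h := (hf ((‖u‖ + ε / c)⁻¹ • u) (by
      rw [mem_ball_zero_iff, norm_smul, norm_inv, Real.norm_of_nonneg hr.le,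
        inv_mul_lt_iff₀ hr]
      linarith [div_pos hε hc0])).le
    rw [map_smul, smul_eq_mul, inv_mul_le_iff₀ hr, add_mul, div_mul_cancel₀ _ hc0.ne'] at h
    linarith
  have hle' : ∀ u, (c⁻¹ • f) u ≤ ‖u‖ := fun u => by
    rw [_root_.smul_apply, smul_eq_mul, inv_mul_le_iff₀ hc0]
    exact hle u
  refine ⟨c⁻¹ • f, hle', fun x hx hxk => le_antisymm ?_ ?_⟩
  · exact (hle' _).trans (hG.norm_map x hx).le
  · rw [_root_.smul_apply, smul_eq_mul, le_inv_mul_iff₀ hc0, mul_one]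
    exact hc _ ⟨x, hx, hxk, rfl⟩

variable {φ : X →L[ℝ] ℝ} {k : Γ} {ν : ℂ}

theorem one_sub_norm_sub_le (hG : IsSphereIsometry_s16 G) (hφ : SupportsFace G φ k ν) (hν : ‖ν‖ = 1)
    {x : C₀(Γ, ℂ)} (hx : ‖x‖ = 1) : 1 - ‖x k - ν‖ ≤ φ (G x) := by
  have hy := norm_update_eq_one hx.le k hν
  have h1 := hφ.map_eq_one _ hy (by simp)
  have h2 := hφ.le_norm (G (x.update k ν) - G x)
  rw [map_sub, h1, norm_sub_rev, hG.norm_map_sub _ _ hx hy] at h2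
  linarith [norm_sub_update_le x k ν]

theorem map_le_norm_add_sub_one (hG : IsSphereIsometry_s16 G) (hφ : SupportsFace G φ k ν) (hν : ‖ν‖ = 1)
    {x : C₀(Γ, ℂ)} (hx : ‖x‖ = 1) : φ (G x) ≤ ‖x k + ν‖ - 1 := by
  have hν' : ‖-ν‖ = 1 := by rwa [norm_neg]
  have hy := norm_update_eq_one hx.le k hν'
  obtain ⟨z, hz, hzk, hGz⟩ := hG.exists_map_eq_neg hν' hy (update_apply_self x k (-ν))
  have h1 := hφ.map_eq_one z hz (by simpa using hzk)
  rw [hGz, map_neg] at h1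
  have h2 := hφ.le_norm (G x - G (x.update k (-ν)))
  rw [map_sub, hG.norm_map_sub _ _ hx hy] at h2
  have h3 := norm_sub_update_le x k (-ν)
  rw [sub_neg_eq_add] at h3
  linarith

theorem map_eq_zero_of_apply_eq_zero (hG : IsSphereIsometry_s16 G) (hφ : SupportsFace G φ k ν)
    (hν : ‖ν‖ = 1) {x : C₀(Γ, ℂ)} (hx : ‖x‖ = 1) (hxk : x k = 0) : φ (G x) = 0 := by
  have h1 := hG.one_sub_norm_sub_le hφ hν hx
  have h2 := hG.map_le_norm_add_sub_one hφ hν hx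
  simp only [hxk, zero_sub, norm_neg, zero_add, hν] at h1 h2
  linarith

theorem exists_approx_of_ne (hG : IsSphereIsometry_s16 G) {m : Γ} (hmk : k ≠ m) {x : C₀(Γ, ℂ)}
    (hx : ‖x‖ = 1) (hxm : ‖x m‖ = 1) {t : ℝ} (ht : 0 < t) (ht1 : t ≤ 1) :
    ∃ w : ℂ, ∀ ν : ℂ, ‖ν‖ = 1 → ∀ φ, SupportsFace G φ k ν →
      |φ (G x) - ((starRingEnd ℂ) ν * w).re| ≤ t := by
  set e := (0 : C₀(Γ, ℂ)).update m (x m) with he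
  have he1 : ‖e‖ = 1 := norm_update_eq_one (by simp) m hxm
  obtain ⟨y, hy, -, hGy⟩ := hG.exists_map_eq_combination hxm he1 hx (by simp [he]) rfl
    (sub_nonneg.2 ht1) ht.le (sub_add_cancel 1 t)
  have hek : e k = 0 := by rw [he, update_apply_of_ne _ hmk]; rfl
  have hyk : ‖y k‖ ≤ t := by
    have h1 : ‖y - e‖ ≤ t := by
      rw [← hG.norm_map_sub _ _ hy he1, hGy,
        show (1 - t) • G e + t • G x - G e = t • (G x - G e) by module, norm_smul,
        Real.norm_of_nonneg ht.le, hG.norm_map_sub _ _ hx he1]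
      have h2 : ‖x - e‖ ≤ 1 := by
        refine norm_le_of_forall_apply_le zero_le_one fun j => ?_
        by_cases hj : j = m
        · subst hj; simp [he]
        · rw [ZeroAtInftyContinuousMap.sub_apply, he, update_apply_of_ne _ hj,
            ZeroAtInftyContinuousMap.zero_apply, sub_zero]
          exact (norm_apply_le_norm x j).trans hx.le
      nlinarith
    have h3 := norm_apply_le_norm (y - e) k
    rw [ZeroAtInftyContinuousMap.sub_apply, hek, sub_zero] at h3
    exact h3.trans h1
  refine ⟨y k / t, fun ν hν φ hφ => ?_⟩
  have hφy : φ (G y) = t * φ (G x) := by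
    rw [hGy, map_add, map_smul, map_smul, hG.map_eq_zero_of_apply_eq_zero hφ hν he1 hek]
    simp
  have hl := hG.one_sub_norm_sub_le hφ hν hy
  have hu := hG.map_le_norm_add_sub_one hφ hν hy
  have hl' := Complex.norm_add_le_of_norm_eq_one (ν := -ν) (w := y k) (by rwa [norm_neg])
  have hu' := Complex.norm_add_le_of_norm_eq_one (w := y k) hν
  rw [map_neg, neg_mul, Complex.neg_re, ← sub_eq_add_neg] at hl'
  have hre : ((starRingEnd ℂ) ν * (y k / t)).re = ((starRingEnd ℂ) ν * y k).re / t := by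
    rw [← mul_div_assoc, Complex.div_ofReal_re]
  have hsq : ‖y k‖ ^ 2 ≤ t * t := by nlinarith [norm_nonneg (y k)]
  rw [hre, abs_le, ← mul_le_mul_iff_right₀ ht, ← mul_le_mul_iff_right₀ ht (b := _ - _), mul_sub,
    mul_div_cancel₀ _ ht.ne', ← hφy]
  constructor <;> nlinarith

theorem map_eq_of_ne (hG : IsSphereIsometry_s16 G) {m : Γ} (hmk : k ≠ m) {x : C₀(Γ, ℂ)} (hx : ‖x‖ = 1)
    (hxm : ‖x m‖ = 1) (hν : ‖ν‖ = 1) (hφ : SupportsFace G φ k ν) :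
    φ (G x) = ((starRingEnd ℂ) ν * x k).re := by
  obtain ⟨φ₁, hφ₁⟩ := hG.exists_supportsFace k (ν := 1) (by simp)
  obtain ⟨φ₂, hφ₂⟩ := hG.exists_supportsFace k (ν := Complex.I) (by simp)
  set w : ℂ := ⟨φ₁ (G x), φ₂ (G x)⟩ with hw
  have key : ∀ ν : ℂ, ‖ν‖ = 1 → ∀ φ, SupportsFace G φ k ν →
      φ (G x) = ((starRingEnd ℂ) ν * w).re := by
    intro ν hν φ hφ
    refine eq_of_forall_dist_le fun ε hε => ?_
    obtain ⟨t, ht0, ht1, htε⟩ : ∃ t : ℝ, 0 < t ∧ t ≤ 1 ∧ 3 * t ≤ ε :=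
      ⟨min 1 (ε / 3), by positivity, min_le_left _ _, by linarith [min_le_right 1 (ε / 3)]⟩
    obtain ⟨v, hv⟩ := hG.exists_approx_of_ne hmk hx hxm ht0 ht1
    have h0 := hv ν hν φ hφ
    have h1 := hv 1 (by simp) φ₁ hφ₁
    have h2 := hv Complex.I (by simp) φ₂ hφ₂
    have hr := (Complex.abs_re_le_norm ν).trans hν.le
    have hi := (Complex.abs_im_le_norm ν).trans hν.le
    simp only [map_one, one_mul, Complex.conj_I, neg_mul, Complex.neg_re, Complex.I_mul_re,
      neg_neg] at h1 h2
    have hd : φ (G x) - ((starRingEnd ℂ) ν * w).re =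
        (φ (G x) - ((starRingEnd ℂ) ν * v).re) - ν.re * (φ₁ (G x) - v.re)
          - ν.im * (φ₂ (G x) - v.im) := by
      simp [hw]; ring
    rw [Real.dist_eq, hd]
    refine (abs_sub _ _).trans ?_
    refine (add_le_add_left (abs_sub _ _) _).trans ?_
    rw [abs_mul, abs_mul]
    have h3 := mul_le_mul hr h1 (abs_nonneg _) zero_le_one
    have h4 := mul_le_mul hi h2 (abs_nonneg _) zero_le_one
    linarith
  have hwx : w = x k := by
    refine Complex.eq_of_forall_re_conj_mul_le (fun ν hν => ?_)
      ((norm_apply_le_norm x k).trans hx.le)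
    obtain ⟨φ, hφ⟩ := hG.exists_supportsFace k hν
    rw [← key ν hν φ hφ]
    exact hG.map_le_norm_add_sub_one hφ hν hx
  rw [key ν hν φ hφ, hwx]

theorem map_eq (hG : IsSphereIsometry_s16 G) [Nontrivial Γ] {x : C₀(Γ, ℂ)} (hx : ‖x‖ = 1) (hν : ‖ν‖ = 1)
    (hφ : SupportsFace G φ k ν) : φ (G x) = ((starRingEnd ℂ) ν * x k).re := by
  obtain ⟨m, hm⟩ := exists_norm_apply_eq_norm (x := x) (by rw [hx]; exact one_pos)
  rw [hx] at hm
  by_cases hkm : k ≠ m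
  · exact hG.map_eq_of_ne hkm hx hm hν hφ
  obtain rfl : k = m := not_not.1 hkm
  obtain ⟨j, hj⟩ := exists_ne k
  obtain ⟨α, hα, hxα⟩ : ∃ α : ℂ, ‖α‖ = 1 ∧ x j = ‖x j‖ * α := by
    by_cases h0 : x j = 0
    · exact ⟨1, by simp, by simp [h0]⟩
    · exact ⟨x j / ‖x j‖, by simp [h0], by field_simp [norm_ne_zero_iff.2 h0]⟩
  set t := ‖x j‖ with ht
  have ht0 : 0 ≤ t := norm_nonneg _
  have ht1 : t ≤ 1 := (norm_apply_le_norm x j).trans hx.le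
  have hα' : ‖-α‖ = 1 := by rwa [norm_neg]
  set p := x.update j α with hp
  set q := x.update j (-α) with hq
  have hp1 : ‖p‖ = 1 := norm_update_eq_one hx.le j hα
  have hq1 : ‖q‖ = 1 := norm_update_eq_one hx.le j hα'
  have hpi : ∀ i, i ≠ j → p i = x i := fun i hi => update_apply_of_ne x hi α
  have hqi : ∀ i, i ≠ j → q i = x i := fun i hi => update_apply_of_ne x hi (-α)
  have hpj : p j = α := update_apply_self x j α
  have hqj : q j = -α := update_apply_self x j (-α)
  have hpk := hpi k hj.symm
  have hqk := hqi k hj.symm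
  obtain ⟨z, hz, hzk, hGz⟩ := hG.exists_map_eq_combination hm hp1 hq1 hpk hqk
    (s := (1 + t) / 2) (t := (1 - t) / 2) (by linarith) (by linarith) (by ring)
  have hcoord : ∀ i, ((1 + t) / 2 : ℝ) * p i + ((1 - t) / 2 : ℝ) * q i = x i := by
    intro i
    by_cases hi : i = j
    · rw [hi, hpj, hqj, hxα]; push_cast; ring
    · rw [hpi i hi, hqi i hi]; push_cast; ring
  have hzx : z = x := by
    ext i
    by_cases hi : i = k
    · rw [hi, hzk]
    have hform : ∀ β : ℂ, ‖β‖ = 1 →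
        ((starRingEnd ℂ) β * z i).re = ((starRingEnd ℂ) β * x i).re := by
      intro β hβ
      obtain ⟨ψ, hψ⟩ := hG.exists_supportsFace i hβ
      rw [← hG.map_eq_of_ne hi hz (by rw [hzk, hm]) hβ hψ, hGz, map_add, map_smul, map_smul,
        hG.map_eq_of_ne hi hp1 (by rw [hpk, hm]) hβ hψ,
        hG.map_eq_of_ne hi hq1 (by rw [hqk, hm]) hβ hψ, ← hcoord i, mul_add, Complex.add_re,
        mul_left_comm, mul_left_comm _ _ (q i), Complex.re_ofReal_mul, Complex.re_ofReal_mul]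
      rfl
    have h1 := hform 1 (by simp)
    have h2 := hform Complex.I (by simp)
    simp only [map_one, one_mul, Complex.conj_I, neg_mul, Complex.neg_re, Complex.I_mul_re,
      neg_neg] at h1 h2
    exact Complex.ext h1 h2
  rw [← hzx, hGz, map_add, map_smul, map_smul,
    hG.map_eq_of_ne hj.symm hp1 (by rw [hpj, hα]) hν hφ,
    hG.map_eq_of_ne hj.symm hq1 (by rw [hqj, hα']) hν hφ, hpk, hqk, hzk, smul_eq_mul, smul_eq_mul]
  ring

theorem eq_zero_of_forall_supportsFace (hG : IsSphereIsometry_s16 G) {u : X}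
    (h : ∀ k ν φ, ‖ν‖ = 1 → SupportsFace G φ k ν → φ u = 0) : u = 0 := by
  by_contra hu
  have hu' : ‖u‖ ≠ 0 := norm_ne_zero_iff.2 hu
  obtain ⟨x, hx, hGx⟩ := hG.exists_map_eq (‖u‖⁻¹ • u) (by
    rw [norm_smul, norm_inv, norm_norm, inv_mul_cancel₀ hu'])
  obtain ⟨k, hk⟩ := exists_norm_apply_eq_norm (x := x) (by rw [hx]; exact one_pos)
  rw [hx] at hk
  obtain ⟨φ, hφ⟩ := hG.exists_supportsFace k hk
  have h1 := hφ.map_eq_one x hx rfl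
  rw [hGx, map_smul, h k _ φ hk hφ, smul_zero] at h1
  exact zero_ne_one h1

theorem exists_linearIsometry (hG : IsSphereIsometry_s16 G) [Nontrivial Γ] :
    ∃ F : C₀(Γ, ℂ) →ₗᵢ[ℝ] X, Function.Surjective F ∧ ∀ x, ‖x‖ = 1 → F x = G x := by
  have hunit : ∀ x : C₀(Γ, ℂ), x ≠ 0 → ‖‖x‖⁻¹ • x‖ = 1 := fun x hx => by
    rw [norm_smul, norm_inv, norm_norm, inv_mul_cancel₀ (norm_ne_zero_iff.2 hx)]
  set f : C₀(Γ, ℂ) → X := fun x => ‖x‖ • G (‖x‖⁻¹ • x) with hf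
  have hφf : ∀ k ν φ, ‖ν‖ = 1 → SupportsFace G φ k ν → ∀ x,
      φ (f x) = ((starRingEnd ℂ) ν * x k).re := by
    intro k ν φ hν hφ x
    by_cases hx : x = 0
    · simp [hf, hx]
    · rw [hf, map_smul, hG.map_eq (hunit x hx) hν hφ, ZeroAtInftyContinuousMap.smul_apply,
        mul_smul_comm,
        Complex.real_smul, Complex.re_ofReal_mul, smul_eq_mul, ← mul_assoc,
        mul_inv_cancel₀ (norm_ne_zero_iff.2 hx), one_mul]
  have hfG : ∀ x, ‖x‖ = 1 → f x = G x := fun x hx => by simp [hf, hx]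
  refine ⟨⟨⟨⟨f, fun x y => ?_⟩, fun r x => ?_⟩, fun x => ?_⟩, fun u => ?_, hfG⟩
  · refine sub_eq_zero.1 (hG.eq_zero_of_forall_supportsFace fun k ν φ hν hφ => ?_)
    rw [map_sub, map_add, hφf k ν φ hν hφ, hφf k ν φ hν hφ, hφf k ν φ hν hφ,
      ZeroAtInftyContinuousMap.add_apply, mul_add,
      Complex.add_re, sub_self]
  · refine sub_eq_zero.1 (hG.eq_zero_of_forall_supportsFace fun k ν φ hν hφ => ?_)
    simp only [RingHom.id_apply]
    rw [map_sub, map_smul φ r (f x), hφf k ν φ hν hφ, hφf k ν φ hν hφ,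
      ZeroAtInftyContinuousMap.smul_apply, mul_smul_comm,
      Complex.smul_re, sub_self]
  · change ‖f x‖ = ‖x‖
    by_cases hx : x = 0
    · simp [hf, hx]
    · rw [hf, norm_smul, norm_norm, hG.norm_map _ (hunit x hx), mul_one]
  · change ∃ x, f x = u
    by_cases hu : u = 0
    · exact ⟨0, by simp [hf, hu]⟩
    have hu' : ‖u‖ ≠ 0 := norm_ne_zero_iff.2 hu
    obtain ⟨x, hx, hGx⟩ := hG.exists_map_eq (‖u‖⁻¹ • u) (by
      rw [norm_smul, norm_inv, norm_norm, inv_mul_cancel₀ hu'])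
    refine ⟨‖u‖ • x, ?_⟩
    have hn : ‖‖u‖ • x‖ = ‖u‖ := by rw [norm_smul, norm_norm, hx, mul_one]
    simp only [hf]
    rw [hn, smul_smul, inv_mul_cancel₀ hu', one_smul, hGx, smul_smul, mul_inv_cancel₀ hu',
      one_smul]

end IsSphereIsometry_s16

end SphereIsometry

/-- **The Mazur–Ulam property for `c₀(Γ)`**: every surjective isometry between the unit sphere
of the complex space `c₀(Γ)` and the unit sphere of a complex Banach space `X` admits a unique
extension to a surjective real-linear isometry from `c₀(Γ)` onto `X`. -/
theorem c0_mazur_ulam_property {Γ : Type*} [TopologicalSpace Γ] [DiscreteTopology Γ]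
    [Infinite Γ]
    {X : Type*} [NormedAddCommGroup X] [NormedSpace ℂ X] [CompleteSpace X]
    (Δ : sphere (0 : C₀(Γ, ℂ)) 1 → sphere (0 : X) 1)
    (hΔiso : Isometry Δ) (hΔsurj : Function.Surjective Δ) :
    ∃! F : C₀(Γ, ℂ) →ₗᵢ[ℝ] X, Function.Surjective F ∧
      ∀ x : sphere (0 : C₀(Γ, ℂ)) 1, F (x : C₀(Γ, ℂ)) = (Δ x : X) := by
  classical
  set G : C₀(Γ, ℂ) → X := fun x =>
    if h : ‖x‖ = 1 then (Δ ⟨x, mem_sphere_zero_iff_norm.2 h⟩ : X) else 0 with hGdef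
  have hGx : ∀ (x) (h : ‖x‖ = 1), G x = Δ ⟨x, mem_sphere_zero_iff_norm.2 h⟩ :=
    fun x h => dif_pos h
  have hG : IsSphereIsometry_s16 G := by
    refine ⟨fun x hx => ?_, fun x y hx hy => ?_, fun u hu => ?_⟩
    · rw [hGx x hx]
      exact mem_sphere_zero_iff_norm.1 (Δ _).2
    · rw [hGx x hx, hGx y hy, ← dist_eq_norm, ← dist_eq_norm]
      exact hΔiso.dist_eq _ _
    · obtain ⟨⟨x, hx⟩, hΔx⟩ := hΔsurj ⟨u, mem_sphere_zero_iff_norm.2 hu⟩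
      rw [mem_sphere_zero_iff_norm] at hx
      exact ⟨x, hx, by rw [hGx x hx, hΔx]⟩
  obtain ⟨F, hFsurj, hFG⟩ := hG.exists_linearIsometry
  have hFΔ : ∀ x : sphere (0 : C₀(Γ, ℂ)) 1, F (x : C₀(Γ, ℂ)) = (Δ x : X) := fun x => by
    have hx := mem_sphere_zero_iff_norm.1 x.2
    rw [hFG _ hx, hGx _ hx]
  refine ⟨F, ⟨hFsurj, hFΔ⟩, fun F' hF' => LinearIsometry.ext fun x => ?_⟩
  by_cases hx : x = 0
  · rw [hx, map_zero, map_zero]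
  have hx' : ‖x‖ ≠ 0 := norm_ne_zero_iff.2 hx
  have h := (hF'.2 ⟨‖x‖⁻¹ • x, mem_sphere_zero_iff_norm.2 (by
    rw [norm_smul, norm_inv, norm_norm, inv_mul_cancel₀ hx'])⟩).trans (hFΔ _).symm
  rw [map_smul, map_smul] at h
  exact smul_right_injective X (inv_ne_zero hx') h
end

section
/- Let m ∈ ℕ and X a complex Banach space. Every surjective isometry Δ : S(ℓ∞^m) → S(X) between the unit spheres admits a unique extension to a surjective real-linear isometry from ℓ∞^m onto X; in particular, the finite dimensional complex space ℓ∞^m satisfies the Mazur-Ulam property. -/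
open Metric

section NormedSpace

variable {X : Type*} [NormedAddCommGroup X] [NormedSpace ℝ X]

theorem norm_add_eq_two_of_midpoint {p q u : X} (hp : ‖p‖ = 1) (hq : ‖q‖ = 1) (hu : ‖u‖ = 1)
    (hpq : ‖p + q‖ = 2) (huq : ‖u + q‖ = 2)
    (H : ∀ u w : X, ‖u‖ = 1 → ‖w‖ = 1 → ‖u + q‖ = 2 → ‖w + p‖ = 2 → ‖u + w‖ = 2) :
    ‖u + p‖ = 2 := by
  have hle : ‖u + p‖ ≤ 2 := (norm_add_le u p).trans (by linarith)
  set w : X := (1 / 2 : ℝ) • (p + q) with hw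
  have hw1 : ‖w‖ = 1 := by rw [hw, norm_smul, hpq]; norm_num
  have hwp : ‖w + p‖ = 2 := by
    refine le_antisymm ((norm_add_le w p).trans (by linarith)) ?_
    have h2 : (3 / 2 : ℝ) • (p + q) = (w + p) + q := by rw [hw]; module
    have h3 : ‖(3 / 2 : ℝ) • (p + q)‖ = 3 := by rw [norm_smul, hpq]; norm_num
    have h4 := norm_add_le (w + p) q
    rw [← h2, h3] at h4
    linarith
  have huw := H u w hu hw1 huq hwp
  have h2 : (2 : ℝ) • (u + w) = (u + p) + (u + q) := by rw [hw]; module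
  have h3 : ‖(2 : ℝ) • (u + w)‖ = 4 := by rw [norm_smul, huw]; norm_num
  have h4 := norm_add_le (u + p) (u + q)
  rw [← h2, h3] at h4
  linarith

/-- If two stars in the unit sphere are pairwise at maximal distance from each other's
antipodes, then they are convex. -/
theorem convex_sphere_star {p q : X} (hp : ‖p‖ = 1) (hq : ‖q‖ = 1) (hpq : ‖p + q‖ = 2)
    (H : ∀ u w : X, ‖u‖ = 1 → ‖w‖ = 1 → ‖u + q‖ = 2 → ‖w + p‖ = 2 → ‖u + w‖ = 2) :
    Convex ℝ {u : X | ‖u‖ = 1 ∧ ‖u + q‖ = 2} := by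
  have hBC : ∀ u : X, ‖u‖ = 1 → ‖u + q‖ = 2 → ‖u + p‖ = 2 := fun u hu huq =>
    norm_add_eq_two_of_midpoint hp hq hu hpq huq H
  have hCB : ∀ u : X, ‖u‖ = 1 → ‖u + p‖ = 2 → ‖u + q‖ = 2 := fun u hu hup =>
    norm_add_eq_two_of_midpoint hq hp hu (by rwa [add_comm]) hup fun u w hu hw h1 h2 => by
      rw [add_comm]; exact H w u hw hu h2 h1
  rintro u ⟨hu, huq⟩ v ⟨hv, hvq⟩ a b ha hb hab
  have hup := hBC u hu huq
  set w : X := (1 / 2 : ℝ) • (u + p) with hw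
  have hw1 : ‖w‖ = 1 := by rw [hw, norm_smul, hup]; norm_num
  have hwp : ‖w + p‖ = 2 := by
    refine le_antisymm ((norm_add_le w p).trans (by linarith)) ?_
    have h2 : (3 / 2 : ℝ) • (u + p) = (w + p) + u := by rw [hw]; module
    have h3 : ‖(3 / 2 : ℝ) • (u + p)‖ = 3 := by rw [norm_smul, hup]; norm_num
    have h4 := norm_add_le (w + p) u
    rw [← h2, h3] at h4
    linarith
  have hvw := H v w hv hw1 hvq hwp
  have h3 : 3 ≤ ‖u + v + p‖ := by
    have h2 : (2 : ℝ) • (v + w) = (u + v + p) + v := by rw [hw]; module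
    have h3 : ‖(2 : ℝ) • (v + w)‖ = 4 := by rw [norm_smul, hvw]; norm_num
    have h4 := norm_add_le (u + v + p) v
    rw [← h2, h3] at h4
    linarith
  have hle : ‖a • u + b • v‖ ≤ 1 := by
    refine (norm_add_le _ _).trans ?_
    rw [norm_smul, norm_smul, Real.norm_of_nonneg ha, Real.norm_of_nonneg hb]
    nlinarith
  have hge : 2 ≤ ‖a • u + b • v + p‖ := by
    have h2 : u + v + p = (a • u + b • v + p) + (b • u + a • v) := by
      obtain rfl : b = 1 - a := by linarith
      module
    have h4 := norm_add_le (a • u + b • v + p) (b • u + a • v)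
    have h5 : ‖b • u + a • v‖ ≤ 1 := by
      refine (norm_add_le _ _).trans ?_
      rw [norm_smul, norm_smul, Real.norm_of_nonneg ha, Real.norm_of_nonneg hb]
      nlinarith
    rw [← h2] at h4
    linarith
  have h6 := norm_add_le (a • u + b • v) p
  have h1 : ‖a • u + b • v‖ = 1 := le_antisymm hle (by linarith)
  exact ⟨h1, hCB _ h1 (le_antisymm (by linarith) hge)⟩

end NormedSpace

/-- A convex subset of the unit sphere of a complex normed space is contained in the face
cut out by a complex functional of norm at most one. -/
theorem exists_functional_eq_one_of_convex_sphere {X : Type*} [NormedAddCommGroup X]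
    [NormedSpace ℂ X] {B : Set X} (hB : Convex ℝ B) (hB1 : ∀ u ∈ B, ‖u‖ = 1) :
    ∃ Φ : X →L[ℂ] ℂ, (∀ u, ‖Φ u‖ ≤ ‖u‖) ∧ ∀ u ∈ B, Φ u = 1 := by
  rcases B.eq_empty_or_nonempty with rfl | ⟨b, hb⟩
  · exact ⟨0, by simp, by simp⟩
  obtain ⟨f, s, hf1, hf2⟩ := RCLike.geometric_hahn_banach_open (𝕜 := ℂ)
    (convex_ball (0 : X) 1) isOpen_ball hB (Set.disjoint_left.2 fun u hu hu' => by
      rw [mem_ball_zero_iff, hB1 u hu'] at hu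
      exact lt_irrefl _ hu)
  simp only [mem_ball_zero_iff] at hf1
  have hs : 0 < s := by simpa using hf1 0 (by simp)
  have hball : ∀ u : X, ‖u‖ < 1 → ‖f u‖ ≤ s := by
    intro u hu
    by_cases h0 : f u = 0
    · simp [h0, hs.le]
    have hn : (‖f u‖ : ℂ) ≠ 0 := by simpa using h0
    have h := hf1 (((starRingEnd ℂ) (f u) / ‖f u‖) • u) (by
      rw [norm_smul, norm_div, RCLike.norm_conj, Complex.norm_real, norm_norm,
        div_self (norm_ne_zero_iff.2 h0), one_mul]
      exact hu)
    rw [map_smul, smul_eq_mul, div_mul_eq_mul_div, Complex.conj_mul', sq,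
      mul_div_assoc, div_self hn, mul_one] at h
    simpa using h.le
  have hbd : ∀ u : X, ‖f u‖ ≤ s * ‖u‖ := by
    intro u
    refine le_of_forall_pos_le_add fun ε hε => ?_
    have hpos : 0 < ‖u‖ + ε / s := by positivity
    have h := hball (((‖u‖ + ε / s : ℝ) : ℂ)⁻¹ • u) (by
      rw [norm_smul, norm_inv, Complex.norm_real, Real.norm_of_nonneg hpos.le,
        inv_mul_lt_iff₀ hpos]
      have : 0 < ε / s := by positivity
      linarith)
    rw [map_smul, norm_smul, norm_inv, Complex.norm_real, Real.norm_of_nonneg hpos.le,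
      inv_mul_le_iff₀ hpos] at h
    refine h.trans (le_of_eq ?_)
    field_simp
  have hsc : (s : ℂ) ≠ 0 := by exact_mod_cast hs.ne'
  refine ⟨(s : ℂ)⁻¹ • f, fun u => ?_, fun u hu => ?_⟩
  · change ‖(s : ℂ)⁻¹ * f u‖ ≤ ‖u‖
    rw [norm_mul, norm_inv, Complex.norm_real, Real.norm_of_nonneg hs.le, inv_mul_le_iff₀ hs]
    exact hbd u
  · change (s : ℂ)⁻¹ * f u = 1
    have h1 : s ≤ (f u).re := hf2 u hu
    have h2 := hbd u
    rw [hB1 u hu, mul_one] at h2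
    have h3 : (f u).re = s := le_antisymm ((Complex.re_le_norm _).trans h2) h1
    have h4 : (f u).im = 0 := by
      have h5 := Complex.sq_norm (f u)
      rw [Complex.normSq_apply, h3] at h5
      nlinarith [norm_nonneg (f u), sq_nonneg (f u).im]
    have h6 : f u = s := Complex.ext (by simpa using h3) (by simpa using h4)
    rw [h6, inv_mul_cancel₀ hsc]

section Complex

theorem Complex.eq_neg_of_norm_sub_eq_two {z w : ℂ} (hz : ‖z‖ ≤ 1) (hw : ‖w‖ ≤ 1)
    (h : ‖z - w‖ = 2) : z = -w ∧ ‖w‖ = 1 := by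
  have hp := parallelogram_law_with_norm ℝ z w
  have h0 : ‖z + w‖ = 0 := by
    nlinarith [norm_nonneg z, norm_nonneg w, norm_nonneg (z + w)]
  have hzw : z = -w := eq_neg_of_add_eq_zero_left (norm_eq_zero.1 h0)
  refine ⟨hzw, le_antisymm hw ?_⟩
  have := norm_sub_le z w
  linarith

theorem Complex.normSq_add_normSq_of_norm_one {z : ℂ} (hz : ‖z‖ = 1) :
    z.re * z.re + z.im * z.im = 1 := by
  rw [← Complex.normSq_apply, ← Complex.sq_norm, hz, one_pow]

theorem Complex.inner_le_of_norm_sub_le {z w μ : ℂ} (hz : ‖z‖ = 1) (hw : ‖w‖ = 1)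
    (h : ‖z - μ‖ ≤ ‖w - μ‖) :
    w.re * μ.re + w.im * μ.im ≤ z.re * μ.re + z.im * μ.im := by
  have h2 : ‖z - μ‖ ^ 2 ≤ ‖w - μ‖ ^ 2 := by gcongr
  rw [Complex.sq_norm, Complex.sq_norm, Complex.normSq_apply, Complex.normSq_apply] at h2
  have := Complex.normSq_add_normSq_of_norm_one hz
  have := Complex.normSq_add_normSq_of_norm_one hw
  simp only [Complex.sub_re, Complex.sub_im] at h2
  nlinarith

/-- A point of the plane that is no further than `t` from every point of the unit circle,
where `t` lies in the closed unit disc, equals `t`. -/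
theorem Complex.eq_of_forall_norm_sub_le {z t : ℂ} (ht : ‖t‖ ≤ 1)
    (h : ∀ μ : ℂ, ‖μ‖ = 1 → ‖z - μ‖ ≤ ‖t - μ‖) : z = t := by
  obtain ⟨μ, hμ, r, hr0, hr1, rfl⟩ :
      ∃ μ : ℂ, ‖μ‖ = 1 ∧ ∃ r : ℝ, 0 ≤ r ∧ r ≤ 1 ∧ t = r * μ := by
    by_cases h0 : t = 0
    · exact ⟨1, by simp, 0, le_rfl, zero_le_one, by simp [h0]⟩
    have hn : (‖t‖ : ℂ) ≠ 0 := by simpa using h0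
    refine ⟨t / ‖t‖, ?_, ‖t‖, norm_nonneg _, ht, ?_⟩
    · rw [norm_div, Complex.norm_real, norm_norm, div_self (norm_ne_zero_iff.2 h0)]
    · field_simp
  have e1 : ‖(r : ℂ) * μ - μ‖ = 1 - r := by
    have : (r : ℂ) * μ - μ = ((r - 1 : ℝ) : ℂ) * μ := by push_cast; ring
    rw [this, norm_mul, hμ, mul_one, Complex.norm_real, Real.norm_of_nonpos (by linarith)]
    ring
  have e2 : ‖(r : ℂ) * μ - -μ‖ = 1 + r := by
    have : (r : ℂ) * μ - -μ = ((r + 1 : ℝ) : ℂ) * μ := by push_cast; ring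
    rw [this, norm_mul, hμ, mul_one, Complex.norm_real, Real.norm_of_nonneg (by linarith)]
    ring
  have h1 := h μ hμ
  have h2 := h (-μ) (by rwa [norm_neg])
  rw [e1] at h1
  rw [e2] at h2
  have q1 : ‖z - μ‖ ^ 2 ≤ (1 - r) ^ 2 := by gcongr
  have q2 : ‖z - -μ‖ ^ 2 ≤ (1 + r) ^ 2 := by gcongr
  have hμ2 := Complex.normSq_add_normSq_of_norm_one hμ
  rw [Complex.sq_norm, Complex.normSq_apply] at q1 q2
  simp only [Complex.sub_re, Complex.sub_im, Complex.neg_re, Complex.neg_im] at q1 q2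
  have key : (z.re - r * μ.re) ^ 2 + (z.im - r * μ.im) ^ 2 ≤ 0 := by
    nlinarith [mul_le_mul_of_nonneg_left q1 (by linarith : (0 : ℝ) ≤ (1 + r) / 2),
      mul_le_mul_of_nonneg_left q2 (by linarith : (0 : ℝ) ≤ (1 - r) / 2)]
  have k1 : z.re - r * μ.re = 0 := by nlinarith [sq_nonneg (z.im - r * μ.im)]
  have k2 : z.im - r * μ.im = 0 := by nlinarith [sq_nonneg (z.re - r * μ.re)]
  apply Complex.ext <;> simp <;> linarith

end Complex

section SupNorm

variable {ι : Type*} [Fintype ι]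

theorem Pi.norm_eq_one_of_apply {x : ι → ℂ} (hx : ∀ k, ‖x k‖ ≤ 1) (j : ι) (hj : ‖x j‖ = 1) :
    ‖x‖ = 1 :=
  le_antisymm ((pi_norm_le_iff_of_nonneg zero_le_one).2 hx) (hj ▸ norm_le_pi_norm x j)

theorem Pi.exists_norm_apply_eq {x : ι → ℂ} (hx : 0 < ‖x‖) : ∃ k, ‖x k‖ = ‖x‖ := by
  by_contra! h
  exact lt_irrefl _ ((pi_norm_lt_iff hx).2 fun k => lt_of_le_of_ne (norm_le_pi_norm x k) (h k))

theorem Pi.norm_sub_eq_two_iff {x y : ι → ℂ} (hx : ‖x‖ = 1) (hy : ‖y‖ = 1) :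
    ‖x - y‖ = 2 ↔ ∃ k, ‖y k‖ = 1 ∧ x k = -y k := by
  constructor
  · intro h
    obtain ⟨k, hk⟩ := Pi.exists_norm_apply_eq (x := x - y) (by rw [h]; norm_num)
    rw [h, Pi.sub_apply] at hk
    obtain ⟨h1, h2⟩ := Complex.eq_neg_of_norm_sub_eq_two (hx ▸ norm_le_pi_norm x k)
      (hy ▸ norm_le_pi_norm y k) hk
    exact ⟨k, h2, h1⟩
  · rintro ⟨k, hk, hxy⟩
    refine le_antisymm ((norm_sub_le x y).trans (by linarith)) ?_
    refine le_trans (le_of_eq ?_) (norm_le_pi_norm (x - y) k)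
    rw [Pi.sub_apply, hxy, ← neg_add', norm_neg, ← two_mul, norm_mul, hk]
    norm_num

variable [DecidableEq ι]

theorem Pi.norm_update_eq_one {x : ι → ℂ} (hx : ‖x‖ ≤ 1) (j : ι) {μ : ℂ} (hμ : ‖μ‖ = 1) :
    ‖Function.update x j μ‖ = 1 := by
  refine Pi.norm_eq_one_of_apply (fun k => ?_) j (by simpa using hμ)
  by_cases h : k = j
  · subst h; simp [hμ]
  · simpa [h] using (norm_le_pi_norm x k).trans hx

theorem Pi.norm_sub_update (x : ι → ℂ) (j : ι) (μ : ℂ) :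
    ‖x - Function.update x j μ‖ = ‖x j - μ‖ := by
  have : x - Function.update x j μ = Pi.single j (x j - μ) := by
    ext k
    by_cases h : k = j
    · subst h; simp
    · simp [h]
  rw [this, Pi.norm_single]

end SupNorm

section Coordinates

variable {ι : Type*} [Fintype ι] {X : Type*} [NormedAddCommGroup X]
  [NormedSpace ℂ X] {f : (ι → ℂ) → X}

/-- The image of the face `x j = 1` of the unit ball under a spherical isometry lies in the
face cut out by a complex functional of norm at most one. -/
theorem exists_functional_eq_one_on_face [DecidableEq ι] (hf : ∀ x, ‖x‖ = 1 → ‖f x‖ = 1)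
    (hiso : ∀ x y, ‖x‖ = 1 → ‖y‖ = 1 → ‖f x - f y‖ = ‖x - y‖)
    (hsurj : ∀ u, ‖u‖ = 1 → ∃ x, ‖x‖ = 1 ∧ f x = u) (j : ι) :
    ∃ Φ : X →L[ℂ] ℂ, (∀ u, ‖Φ u‖ ≤ ‖u‖) ∧
      ∀ u, ‖u‖ = 1 → ‖u - f (Pi.single j (-1))‖ = 2 → Φ u = 1 := by
  have e1 : ‖(Pi.single j 1 : ι → ℂ)‖ = 1 := by rw [Pi.norm_single, norm_one]
  have e2 : ‖(Pi.single j (-1) : ι → ℂ)‖ = 1 := by rw [Pi.norm_single, norm_neg, norm_one]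
  have coord : ∀ (x : ι → ℂ) (μ : ℂ), ‖x‖ = 1 → ‖μ‖ = 1 →
      ‖x - Pi.single j μ‖ = 2 → x j = -μ := by
    intro x μ hx hμ h
    obtain ⟨k, hk, hxk⟩ := (Pi.norm_sub_eq_two_iff hx (by rwa [Pi.norm_single])).1 h
    by_cases hkj : k = j
    · subst hkj; simpa using hxk
    · simp [hkj] at hk
  obtain ⟨Φ, h1, h2⟩ := exists_functional_eq_one_of_convex_sphere
    (convex_sphere_star (p := f (Pi.single j 1)) (q := -f (Pi.single j (-1))) (hf _ e1)
      (by rw [norm_neg]; exact hf _ e2)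
      (by
        rw [← sub_eq_add_neg, hiso _ _ e1 e2]
        exact (Pi.norm_sub_eq_two_iff e1 e2).2 ⟨j, by simp, by simp⟩)
      (by
        intro u w hu hw huq hwp
        obtain ⟨x, hx, rfl⟩ := hsurj u hu
        obtain ⟨y, hy, hyw⟩ := hsurj (-w) (by rwa [norm_neg])
        obtain rfl : w = -f y := by rw [hyw, neg_neg]
        rw [← sub_eq_add_neg, hiso _ _ hx e2] at huq
        rw [← norm_neg, neg_add, neg_neg, ← sub_eq_add_neg, hiso _ _ hy e1] at hwp
        have hxj := coord x (-1) hx (by simp) huq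
        have hyj := coord y 1 hy (by simp) hwp
        rw [← sub_eq_add_neg, hiso _ _ hx hy]
        exact (Pi.norm_sub_eq_two_iff hx hy).2 ⟨j, by simp [hyj], by simp [hxj, hyj]⟩))
    (fun u hu => hu.1)
  exact ⟨Φ, h1, fun u hu hu2 => h2 u ⟨hu, by rwa [← sub_eq_add_neg]⟩⟩

/-- Multiplication by a unimodular scalar permutes the images of the faces `x j = ν`. -/
theorem exists_face_eq_of_norm_one [DecidableEq ι] (hf : ∀ x, ‖x‖ = 1 → ‖f x‖ = 1)
    (hiso : ∀ x y, ‖x‖ = 1 → ‖y‖ = 1 → ‖f x - f y‖ = ‖x - y‖)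
    (hsurj : ∀ u, ‖u‖ = 1 → ∃ x, ‖x‖ = 1 ∧ f x = u) (j : ι) {Φ : X →L[ℂ] ℂ}
    (hΦ : ∀ u, ‖Φ u‖ ≤ ‖u‖)
    (hΦ1 : ∀ u, ‖u‖ = 1 → ‖u - f (Pi.single j (-1))‖ = 2 → Φ u = 1) {c : ℂ} (hc : ‖c‖ = 1) :
    ∃ ν : ℂ, ‖ν‖ = 1 ∧ ν.re = c.re ∧ ∀ x, ‖x‖ = 1 → x j = ν → Φ (f x) = c := by
  have e1 : ‖(Pi.single j 1 : ι → ℂ)‖ = 1 := by rw [Pi.norm_single, norm_one]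
  have e2 : ‖(Pi.single j (-1) : ι → ℂ)‖ = 1 := by rw [Pi.norm_single, norm_neg, norm_one]
  have hone : ∀ x : ι → ℂ, ‖x‖ = 1 → x j = 1 → Φ (f x) = 1 := fun x hx hxj =>
    hΦ1 _ (hf x hx) (by
      rw [hiso _ _ hx e2]
      exact (Pi.norm_sub_eq_two_iff hx e2).2 ⟨j, by simp, by simp [hxj]⟩)
  by_cases hc1 : c = 1
  · subst hc1
    exact ⟨1, by simp, rfl, hone⟩
  have hc0 : c ≠ 0 := by rintro rfl; simp at hc
  obtain ⟨y, hy, hfy⟩ := hsurj (c • f (Pi.single j (-1))) (by rw [norm_smul, hc, hf _ e2, one_mul])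
  have hface : ∀ k, ‖y k‖ = 1 → ∀ x, ‖x‖ = 1 → x k = -y k → Φ (f x) = c := by
    intro k hk x hx hxk
    have h := (Pi.norm_sub_eq_two_iff hx hy).2 ⟨k, hk, hxk⟩
    have h1 : Φ (c⁻¹ • f x) = 1 := by
      apply hΦ1
      · rw [norm_smul, norm_inv, hc, hf x hx]; norm_num
      · have : c⁻¹ • f x - f (Pi.single j (-1)) = c⁻¹ • (f x - f y) := by
          rw [hfy, smul_sub, inv_smul_smul₀ hc0]
        rw [this, norm_smul, norm_inv, hc, hiso _ _ hx hy, h]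
        norm_num
    rw [map_smul, smul_eq_mul, inv_mul_eq_one₀ hc0] at h1
    exact h1.symm
  have hj : ∀ k, ‖y k‖ = 1 → k = j := by
    intro k hk
    by_contra hkj
    have hx : ‖Function.update (Pi.single j (1 : ℂ) : ι → ℂ) k (-y k)‖ = 1 :=
      Pi.norm_update_eq_one e1.le k (by rwa [norm_neg])
    have h1 := hface k hk _ hx (by simp)
    rw [hone _ hx (by simp [Ne.symm hkj])] at h1
    exact hc1 h1.symm
  have hyj : ‖y j‖ = 1 := by
    obtain ⟨k, hk⟩ := Pi.exists_norm_apply_eq (x := y) (by rw [hy]; norm_num)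
    rw [hy] at hk
    rwa [← hj k hk]
  have hle1 : ‖c - 1‖ ≤ ‖-y j - 1‖ := by
    have e3 : ‖(Pi.single j (-y j) : ι → ℂ)‖ = 1 := by rwa [Pi.norm_single, norm_neg]
    have h := hΦ (f (Pi.single j (-y j)) - f (Pi.single j 1))
    rw [map_sub, hface j hyj _ e3 (by simp), hone _ e1 (by simp), hiso _ _ e3 e1,
      ← Pi.single_sub, Pi.norm_single] at h
    exact h
  have hle2 : ‖-y j - 1‖ ≤ ‖c - 1‖ := by
    obtain ⟨x, hx, hfx⟩ := hsurj (c • f (Pi.single j 1)) (by rw [norm_smul, hc, hf _ e1, one_mul])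
    have h2 : ‖x - y‖ = 2 := by
      rw [← hiso _ _ hx hy, hfx, hfy, ← smul_sub, norm_smul, hc, one_mul, hiso _ _ e1 e2]
      exact (Pi.norm_sub_eq_two_iff e1 e2).2 ⟨j, by simp, by simp⟩
    obtain ⟨k, hk, hxk⟩ := (Pi.norm_sub_eq_two_iff hx hy).1 h2
    obtain rfl := hj k hk
    have h3 : ‖x - Pi.single k 1‖ = ‖c - 1‖ := by
      rw [← hiso _ _ hx e1, hfx]
      have : c • f (Pi.single k 1) - f (Pi.single k 1) = (c - 1) • f (Pi.single k 1) := by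
        rw [sub_smul, one_smul]
      rw [this, norm_smul, hf _ e1, mul_one]
    have h4 := norm_le_pi_norm (x - Pi.single k 1) k
    rw [h3, Pi.sub_apply, hxk, Pi.single_eq_same] at h4
    exact h4
  have hν : ‖-y j‖ = 1 := by rwa [norm_neg]
  refine ⟨-y j, hν, le_antisymm ?_ ?_, hface j hyj⟩
  · simpa using Complex.inner_le_of_norm_sub_le hc hν hle1
  · simpa using Complex.inner_le_of_norm_sub_le hν hc hle2

/-- A spherical isometry on `ℓ∞` has each coordinate recovered by a contractive real-linear
map on the target. -/
theorem exists_coordinate_functional (hf : ∀ x, ‖x‖ = 1 → ‖f x‖ = 1)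
    (hiso : ∀ x y, ‖x‖ = 1 → ‖y‖ = 1 → ‖f x - f y‖ = ‖x - y‖)
    (hsurj : ∀ u, ‖u‖ = 1 → ∃ x, ‖x‖ = 1 ∧ f x = u) (j : ι) :
    ∃ Ψ : X →ₗ[ℝ] ℂ, ∀ x, ‖x‖ = 1 → Ψ (f x) = x j := by
  classical
  obtain ⟨Φ, hΦ, hΦ1⟩ := exists_functional_eq_one_on_face hf hiso hsurj j
  have hν := fun {c : ℂ} (hc : ‖c‖ = 1) =>
    exists_face_eq_of_norm_one hf hiso hsurj j hΦ hΦ1 hc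
  have hlip : ∀ {c ν d μ : ℂ}, ‖ν‖ = 1 → ‖μ‖ = 1 →
      (∀ x, ‖x‖ = 1 → x j = ν → Φ (f x) = c) → (∀ x, ‖x‖ = 1 → x j = μ → Φ (f x) = d) →
      ‖c - d‖ ≤ ‖ν - μ‖ := by
    intro c ν d μ h1 h2 h3 h4
    have e1 : ‖(Pi.single j ν : ι → ℂ)‖ = 1 := by rwa [Pi.norm_single]
    have e2 : ‖(Pi.single j μ : ι → ℂ)‖ = 1 := by rwa [Pi.norm_single]
    have h := hΦ (f (Pi.single j ν) - f (Pi.single j μ))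
    rwa [map_sub, h3 _ e1 (by simp), h4 _ e2 (by simp), hiso _ _ e1 e2,
      ← Pi.single_sub, Pi.norm_single] at h
  suffices h : ∃ Ψ : X →ₗ[ℝ] ℂ, (∀ u, ‖Ψ u‖ ≤ ‖u‖) ∧
      ∀ x, ‖x‖ = 1 → ‖x j‖ = 1 → Ψ (f x) = x j by
    obtain ⟨Ψ, h1, h2⟩ := h
    refine ⟨Ψ, fun x hx => Complex.eq_of_forall_norm_sub_le (hx ▸ norm_le_pi_norm x j) ?_⟩
    intro μ hμ
    have hy := Pi.norm_update_eq_one hx.le j hμ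
    have h := h1 (f x - f (Function.update x j μ))
    rwa [map_sub, h2 _ hy (by simpa using hμ), hiso _ _ hx hy, Pi.norm_sub_update,
      Function.update_self] at h
  obtain ⟨a, ha, hare, haΦ⟩ := hν Complex.norm_I
  obtain ⟨b, hb, hbre, hbΦ⟩ := hν (c := -Complex.I) (by simp)
  have ha2 := Complex.normSq_add_normSq_of_norm_one ha
  have hb2 := Complex.normSq_add_normSq_of_norm_one hb
  simp only [Complex.I_re, Complex.neg_re, neg_zero] at hare hbre
  rw [hare] at ha2
  rw [hbre] at hb2
  have hab : b.im = -a.im := by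
    have h := hlip ha hb haΦ hbΦ
    rw [sub_neg_eq_add, ← two_mul, norm_mul, Complex.norm_I] at h
    have h' : (2 : ℝ) ^ 2 ≤ ‖a - b‖ ^ 2 := by
      gcongr
      simpa using h
    rw [Complex.sq_norm, Complex.normSq_apply] at h'
    simp only [Complex.sub_re, Complex.sub_im, hare, hbre] at h'
    have : (b.im + a.im) ^ 2 ≤ 0 := by nlinarith
    nlinarith
  have him : ∀ {c ν : ℂ}, ‖c‖ = 1 → ‖ν‖ = 1 → (∀ x, ‖x‖ = 1 → x j = ν → Φ (f x) = c) →
      c.im = ν.im * a.im := by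
    intro c ν hc hν hΦν
    have h1 := hlip hν ha hΦν haΦ
    have h2 := hlip hν hb hΦν hbΦ
    have hc2 := Complex.normSq_add_normSq_of_norm_one hc
    have hν2 := Complex.normSq_add_normSq_of_norm_one hν
    have q1 : ‖c - Complex.I‖ ^ 2 ≤ ‖ν - a‖ ^ 2 := by gcongr
    have q2 : ‖c - -Complex.I‖ ^ 2 ≤ ‖ν - b‖ ^ 2 := by gcongr
    simp only [Complex.sq_norm, Complex.normSq_apply, Complex.sub_re, Complex.sub_im,
      Complex.neg_re, Complex.neg_im, Complex.I_re, Complex.I_im, hare, hbre, hab] at q1 q2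
    nlinarith
  have ha3 : a.im = 1 ∨ a.im = -1 := by
    have : (a.im - 1) * (a.im + 1) = 0 := by linarith
    rcases mul_eq_zero.1 this with h | h
    · left; linarith
    · right; linarith
  rcases ha3 with ha3 | ha3
  · refine ⟨Φ.toLinearMap.restrictScalars ℝ, hΦ, fun x hx hxj => ?_⟩
    obtain ⟨ν, hν1, hνre, hνΦ⟩ := hν hxj
    have h := him hxj hν1 hνΦ
    rw [ha3, mul_one] at h
    exact hνΦ x hx (Complex.ext hνre.symm h)
  · refine ⟨Complex.conjAe.toLinearMap ∘ₗ Φ.toLinearMap.restrictScalars ℝ,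
      fun u => ?_, fun x hx hxj => ?_⟩
    · change ‖(starRingEnd ℂ) (Φ u)‖ ≤ ‖u‖
      rw [RCLike.norm_conj]
      exact hΦ u
    · change (starRingEnd ℂ) (Φ (f x)) = x j
      obtain ⟨ν, hν1, hνre, hνΦ⟩ := hν (c := (starRingEnd ℂ) (x j)) (by rwa [RCLike.norm_conj])
      have h := him (by rwa [RCLike.norm_conj]) hν1 hνΦ
      rw [ha3, Complex.conj_im] at h
      rw [Complex.conj_re] at hνre
      rw [hνΦ x hx (Complex.ext hνre.symm (by linarith)), Complex.conj_conj]

/-- A surjective isometry between the unit spheres of `ℓ∞` and a complex normed space has a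
real-linear isometric left inverse defined on the whole target. -/
theorem exists_linearIsometryEquiv_left_inverse (hf : ∀ x, ‖x‖ = 1 → ‖f x‖ = 1)
    (hiso : ∀ x y, ‖x‖ = 1 → ‖y‖ = 1 → ‖f x - f y‖ = ‖x - y‖)
    (hsurj : ∀ u, ‖u‖ = 1 → ∃ x, ‖x‖ = 1 ∧ f x = u) :
    ∃ G : X ≃ₗᵢ[ℝ] (ι → ℂ), ∀ x, ‖x‖ = 1 → G (f x) = x := by
  choose Ψ hΨ using exists_coordinate_functional hf hiso hsurj
  have hG : ∀ x, ‖x‖ = 1 → LinearMap.pi Ψ (f x) = x := fun x hx => funext fun j => hΨ j x hx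
  have hnorm : ∀ u, ‖LinearMap.pi Ψ u‖ = ‖u‖ := by
    intro u
    by_cases hu : u = 0
    · simp [hu]
    have hu' : ‖u‖ ≠ 0 := norm_ne_zero_iff.2 hu
    obtain ⟨x, hx, hfx⟩ := hsurj (‖u‖⁻¹ • u) (by
      rw [norm_smul, norm_inv, norm_norm, inv_mul_cancel₀ hu'])
    have h : u = ‖u‖ • f x := by rw [hfx, smul_inv_smul₀ hu']
    rw [h, map_smul, hG x hx, norm_smul, norm_smul, hx, hf x hx]
  refine ⟨LinearIsometryEquiv.ofSurjective ⟨LinearMap.pi Ψ, hnorm⟩ fun x => ?_, hG⟩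
  by_cases hx : x = 0
  · exact ⟨0, by simp [hx]⟩
  have hx' : ‖x‖ ≠ 0 := norm_ne_zero_iff.2 hx
  refine ⟨‖x‖ • f (‖x‖⁻¹ • x), ?_⟩
  change LinearMap.pi Ψ (‖x‖ • f (‖x‖⁻¹ • x)) = x
  rw [map_smul, hG _ (by rw [norm_smul, norm_inv, norm_norm, inv_mul_cancel₀ hx']),
    smul_inv_smul₀ hx']

end Coordinates

/-- **The Mazur–Ulam property for `ℓ∞^m`**: every surjective isometry between the unit sphere
of the finite dimensional complex space `ℓ∞^m = (ℂ^m, ‖·‖∞)` and the unit sphere of a complex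
Banach space `X` admits a unique extension to a surjective real-linear isometry. -/
theorem linfty_m_mazur_ulam_property (m : ℕ) (hm : 0 < m)
    {X : Type*} [NormedAddCommGroup X] [NormedSpace ℂ X] [CompleteSpace X]
    (Δ : sphere (0 : Fin m → ℂ) 1 → sphere (0 : X) 1)
    (hΔiso : Isometry Δ) (hΔsurj : Function.Surjective Δ) :
    ∃! F : (Fin m → ℂ) →ₗᵢ[ℝ] X, Function.Surjective F ∧
      ∀ x : sphere (0 : Fin m → ℂ) 1, F (x : Fin m → ℂ) = (Δ x : X) := by
  classical
  set f : (Fin m → ℂ) → X := fun x =>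
    if h : x ∈ sphere (0 : Fin m → ℂ) 1 then (Δ ⟨x, h⟩ : X) else 0 with hfdef
  have hfΔ : ∀ x : sphere (0 : Fin m → ℂ) 1, f x = Δ x := fun x => dif_pos x.2
  obtain ⟨G, hG⟩ : ∃ G : X ≃ₗᵢ[ℝ] (Fin m → ℂ), ∀ x, ‖x‖ = 1 → G (f x) = x := by
    apply exists_linearIsometryEquiv_left_inverse
    · intro x hx
      rw [hfΔ ⟨x, mem_sphere_zero_iff_norm.2 hx⟩]
      exact mem_sphere_zero_iff_norm.1 (Δ _).2
    · intro x y hx hy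
      rw [hfΔ ⟨x, mem_sphere_zero_iff_norm.2 hx⟩, hfΔ ⟨y, mem_sphere_zero_iff_norm.2 hy⟩,
        ← dist_eq_norm, ← dist_eq_norm]
      exact hΔiso.dist_eq ⟨x, _⟩ ⟨y, _⟩
    · intro u hu
      obtain ⟨x, hx⟩ := hΔsurj ⟨u, mem_sphere_zero_iff_norm.2 hu⟩
      exact ⟨x, mem_sphere_zero_iff_norm.1 x.2, by rw [hfΔ, hx]⟩
  refine ⟨G.symm.toLinearIsometry, ⟨G.symm.surjective, fun x => ?_⟩, ?_⟩
  · change G.symm x = Δ x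
    rw [← hfΔ, LinearIsometryEquiv.symm_apply_eq, hG _ (mem_sphere_zero_iff_norm.1 x.2)]
  · rintro F ⟨-, hF⟩
    ext1 x
    change F x = G.symm x
    by_cases hx : x = 0
    · simp [hx]
    have hx' : ‖x‖ ≠ 0 := norm_ne_zero_iff.2 hx
    have h1 : ‖‖x‖⁻¹ • x‖ = 1 := by rw [norm_smul, norm_inv, norm_norm, inv_mul_cancel₀ hx']
    have h2 : F (‖x‖⁻¹ • x) = G.symm (‖x‖⁻¹ • x) := by
      rw [hF ⟨_, mem_sphere_zero_iff_norm.2 h1⟩, ← hfΔ]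
      exact (G.symm_apply_eq.2 (hG _ h1).symm).symm
    rw [map_smul, map_smul] at h2
    exact smul_right_injective X (inv_ne_zero hx') h2
end
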